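/- arXiv:1905.10874 — 11 statements merged into one kernel-verified Lean document; each statement's English description precedes it below -/
import Mathlib

section
/- Let f : ℝ^d → ℝ be twice continuously differentiable and convex with gradient g and Hessian H, let Q ⊆ ℝ^d be a convex set, and let c ≥ 1 be such that ‖z−y‖²_{H(z)} ≤ c·‖z−y‖²_{H(y)} for all y, z ∈ Q (c-stability). Then for all x, y ∈ Q: f(x) ≤ f(y) + ⟨g(y), x−y⟩ + (c/2)‖x−y‖²_{H(y)} (relative smoothness with constant c) and f(x) ≥ f(y) + ⟨g(y), x−y⟩ + (1/(2c))‖x−y‖²_{H(y)} (relative convexity with constant 1/c). -/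
open Matrix

lemma taylor_aux (φ φ' φ'' : ℝ → ℝ) (K : ℝ) (h1 : ∀ t, HasDerivAt φ (φ' t) t)
    (h2 : ∀ t, HasDerivAt φ' (φ'' t) t) (h3 : ∀ t, 0 < t → t < 1 → φ'' t ≤ K) :
    φ 1 ≤ φ 0 + φ' 0 + K / 2 := by
  have d1 : ∀ t, HasDerivAt (fun t => φ' t - K * t) (φ'' t - K * 1) t := fun t =>
    (h2 t).sub ((hasDerivAt_id t).const_mul K)
  have a1 : AntitoneOn (fun t => φ' t - K * t) (Set.Icc 0 1) := by
    apply antitoneOn_of_deriv_nonpos (convex_Icc 0 1)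
    · exact fun t _ => (d1 t).continuousAt.continuousWithinAt
    · exact fun t _ => (d1 t).differentiableAt.differentiableWithinAt
    · intro t ht
      rw [interior_Icc] at ht
      rw [(d1 t).deriv]
      linarith [h3 t ht.1 ht.2]
  have d2 : ∀ t, HasDerivAt (fun t => φ t - φ' 0 * t - K / 2 * t ^ 2)
      (φ' t - φ' 0 * 1 - K / 2 * ((2 : ℕ) * t ^ (2 - 1))) t := fun t =>
    ((h1 t).sub ((hasDerivAt_id t).const_mul (φ' 0))).sub ((hasDerivAt_pow 2 t).const_mul (K / 2))
  have a2 : AntitoneOn (fun t => φ t - φ' 0 * t - K / 2 * t ^ 2) (Set.Icc 0 1) := by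
    apply antitoneOn_of_deriv_nonpos (convex_Icc 0 1)
    · exact fun t _ => (d2 t).continuousAt.continuousWithinAt
    · exact fun t _ => (d2 t).differentiableAt.differentiableWithinAt
    · intro t ht
      rw [interior_Icc] at ht
      rw [(d2 t).deriv]
      have := a1 (Set.left_mem_Icc.2 zero_le_one) ⟨ht.1.le, ht.2.le⟩ ht.1.le
      norm_num at this ⊢
      linarith
  have := a2 (Set.left_mem_Icc.2 zero_le_one) (Set.right_mem_Icc.2 zero_le_one) zero_le_one
  norm_num at this
  linarith

/-- If `f : ℝ^d → ℝ` is convex and twice continuously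
differentiable (gradient `g`, Hessian `H`), `Q` is a convex set and `c ≥ 1` is
such that `‖z-y‖²_{H(z)} ≤ c‖z-y‖²_{H(y)}` for all `y, z ∈ Q` (`c`-stability),
then on `Q` the function `f` is relatively smooth with constant `c` and
relatively convex with constant `1/c`. -/
theorem stmt3 {d : ℕ} (f : (Fin d → ℝ) → ℝ)
    (g : (Fin d → ℝ) → (Fin d → ℝ))
    (H : (Fin d → ℝ) → Matrix (Fin d) (Fin d) ℝ)
    (hf : ContDiff ℝ 2 f) (hconv : ConvexOn ℝ Set.univ f)
    (hg : ∀ x v, fderiv ℝ f x v = g x ⬝ᵥ v)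
    (hH : ∀ x u v, fderiv ℝ (fun z => fderiv ℝ f z u) x v = u ⬝ᵥ (H x *ᵥ v))
    (Q : Set (Fin d → ℝ)) (hQ : Convex ℝ Q)
    (c : ℝ) (hc : 1 ≤ c)
    (hstab : ∀ y ∈ Q, ∀ z ∈ Q,
      (H z *ᵥ (z - y)) ⬝ᵥ (z - y) ≤ c * ((H y *ᵥ (z - y)) ⬝ᵥ (z - y))) :
    ∀ x ∈ Q, ∀ y ∈ Q,
      f x ≤ f y + g y ⬝ᵥ (x - y) + (c / 2) * ((H y *ᵥ (x - y)) ⬝ᵥ (x - y)) ∧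
      f y + g y ⬝ᵥ (x - y) + (1 / (2 * c)) * ((H y *ᵥ (x - y)) ⬝ᵥ (x - y)) ≤ f x := by
  intro x hx y hy
  obtain ⟨v, hv⟩ : ∃ v, v = x - y := ⟨_, rfl⟩
  have hl : ∀ t : ℝ, HasDerivAt (fun t : ℝ => y + t • v) v t := fun t => by
    simpa using ((hasDerivAt_id t).smul_const v).const_add y
  have hdf : Differentiable ℝ f := hf.differentiable (by norm_num)
  have hdf' : Differentiable ℝ (fun z => fderiv ℝ f z v) := by
    have : ContDiff ℝ 1 (fderiv ℝ f) := hf.fderiv_right (by norm_num)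
    exact (this.differentiable (by norm_num)).clm_apply (differentiable_const v)
  have h1 : ∀ t : ℝ, HasDerivAt (fun t : ℝ => f (y + t • v)) (fderiv ℝ f (y + t • v) v) t :=
    fun t => (hdf (y + t • v)).hasFDerivAt.comp_hasDerivAt t (hl t)
  have h2 : ∀ t : ℝ, HasDerivAt (fun t : ℝ => fderiv ℝ f (y + t • v) v)
      ((H (y + t • v) *ᵥ v) ⬝ᵥ v) t := fun t => by
    have := (hdf' (y + t • v)).hasFDerivAt.comp_hasDerivAt t (hl t)
    rw [hH, dotProduct_comm] at this
    exact this
  have hq : ∀ t : ℝ, 0 < t → t < 1 →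
      (H (y + t • v) *ᵥ v) ⬝ᵥ v ≤ c * ((H y *ᵥ v) ⬝ᵥ v) ∧
      (H y *ᵥ v) ⬝ᵥ v ≤ c * ((H (y + t • v) *ᵥ v) ⬝ᵥ v) := by
    intro t h0 h1
    have hz : y + t • v ∈ Q := by
      rw [hv]; exact hQ.add_smul_sub_mem hy hx ⟨h0.le, h1.le⟩
    have e1 := hstab y hy _ hz
    have e2 := hstab _ hz y hy
    have r1 : y + t • v - y = t • v := by abel
    have r2 : y - (y + t • v) = -(t • v) := by abel
    rw [r1] at e1
    rw [r2] at e2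
    simp only [mulVec_neg, mulVec_smul, neg_dotProduct, dotProduct_neg, neg_neg, smul_dotProduct,
      dotProduct_smul, smul_eq_mul] at e1 e2
    have ht : 0 < t * t := mul_pos h0 h0
    constructor
    · refine le_of_mul_le_mul_left ?_ ht
      linarith
    · refine le_of_mul_le_mul_left ?_ ht
      linarith
  have c0 : 0 < c := by linarith
  rw [← hv, ← hg]
  have hyx : y + v = x := by rw [hv]; abel
  constructor
  · have := taylor_aux _ _ _ _ h1 h2 (fun t a b => (hq t a b).1)
    simp only [one_smul, zero_smul, add_zero, hyx] at this
    linarith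
  · have := taylor_aux _ _ _ (-((H y *ᵥ v) ⬝ᵥ v / c)) (fun t => (h1 t).neg) (fun t => (h2 t).neg)
      (fun t a b => by
        have := (hq t a b).2
        rw [neg_le_neg_iff, div_le_iff₀ c0]
        linarith)
    simp only [Pi.neg_apply, one_smul, zero_smul, add_zero, hyx] at this
    have e : 1 / (2 * c) * ((H y *ᵥ v) ⬝ᵥ v) = (H y *ᵥ v) ⬝ᵥ v / c / 2 := by
      field_simp
    rw [e]
    linarith
end

section
/- Let f : ℝ^d → ℝ be convex and twice continuously differentiable with gradient g and Hessian H, let x₀ ∈ ℝ^d, Q = {x : f(x) ≤ f(x₀)}, and suppose f is relatively smooth on Q with constant L̂ > 0 and g(x) ∈ Range(H(x)) for all x ∈ ℝ^d. Consider the Newton iterates x_{k+1} = x_k − γ H(x_k)† g(x_k) with stepsize 0 < γ ≤ 1/L̂. Then f(x_{k+1}) ≤ f(x_k) for all k ≥ 0, and consequently x_k ∈ Q for all k ≥ 0. -/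
open Matrix

/-- The four Moore–Penrose conditions characterizing the pseudoinverse. -/
def IsMoorePenrose {n : ℕ} (M Md : Matrix (Fin n) (Fin n) ℝ) : Prop :=
  M * Md * M = M ∧ Md * M * Md = Md ∧ (M * Md)ᵀ = M * Md ∧ (Md * M)ᵀ = Md * M

lemma aux_psd {d : ℕ} (f : (Fin d → ℝ) → ℝ)
    (H : (Fin d → ℝ) → Matrix (Fin d) (Fin d) ℝ)
    (hf : ContDiff ℝ 2 f) (hconv : ConvexOn ℝ Set.univ f)
    (hH : ∀ x u v, fderiv ℝ (fun z => fderiv ℝ f z u) x v = u ⬝ᵥ (H x *ᵥ v))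
    (x u : Fin d → ℝ) : 0 ≤ u ⬝ᵥ (H x *ᵥ u) := by
  have hdf : Differentiable ℝ f := hf.differentiable (by norm_num)
  have hd2 : Differentiable ℝ (fderiv ℝ f) :=
    (hf.fderiv_right (m := 1) (by norm_num)).differentiable (by norm_num)
  have hline : ∀ t : ℝ, HasDerivAt (fun t : ℝ => x + t • u) u t := fun t => by
    simpa using ((hasDerivAt_id t).smul_const u).const_add x
  have h1 : ∀ t : ℝ, HasDerivAt (fun t : ℝ => f (x + t • u)) (fderiv ℝ f (x + t • u) u) t :=
    fun t => (hdf (x + t • u)).hasFDerivAt.comp_hasDerivAt t (hline t)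
  have hc : ConvexOn ℝ Set.univ (fun t : ℝ => f (x + t • u)) := by
    refine ⟨convex_univ, fun a _ b _ p q hp hq hpq => ?_⟩
    have := hconv.2 (Set.mem_univ (x + a • u)) (Set.mem_univ (x + b • u)) hp hq hpq
    convert this using 2
    have : x = (p + q) • x := by rw [hpq, one_smul]
    nth_rewrite 1 [this]
    simp only [smul_eq_mul]
    module
  have hm : Monotone (fun t : ℝ => fderiv ℝ f (x + t • u) u) := by
    have := hc.monotoneOn_deriv (fun t _ => (h1 t).differentiableAt)
    intro a b hab
    have h := this (Set.mem_univ a) (Set.mem_univ b) hab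
    rwa [(h1 a).deriv, (h1 b).deriv] at h
  have h2 : HasDerivAt (fun t : ℝ => fderiv ℝ f (x + t • u) u) (u ⬝ᵥ (H x *ᵥ u)) 0 := by
    have hd : DifferentiableAt ℝ (fun z => fderiv ℝ f z u) (x + (0:ℝ) • u) := by
      exact (hd2 _).clm_apply (differentiableAt_const u)
    have := hd.hasFDerivAt.comp_hasDerivAt (0:ℝ) (hline 0)
    rw [hH] at this
    simpa [Function.comp_def] using this
  rw [← h2.deriv]
  exact hm.deriv_nonneg

lemma aux_symm {d : ℕ} (f : (Fin d → ℝ) → ℝ)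
    (H : (Fin d → ℝ) → Matrix (Fin d) (Fin d) ℝ)
    (hf : ContDiff ℝ 2 f)
    (hH : ∀ x u v, fderiv ℝ (fun z => fderiv ℝ f z u) x v = u ⬝ᵥ (H x *ᵥ v))
    (x u v : Fin d → ℝ) : u ⬝ᵥ (H x *ᵥ v) = v ⬝ᵥ (H x *ᵥ u) := by
  have hd2 : Differentiable ℝ (fderiv ℝ f) :=
    (hf.fderiv_right (m := 1) (by norm_num)).differentiable (by norm_num)
  have key : ∀ u v, fderiv ℝ (fun z => fderiv ℝ f z u) x v = fderiv ℝ (fderiv ℝ f) x v u := by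
    intro u v
    rw [fderiv_clm_apply (hd2 x) (differentiableAt_const u)]
    simp
  rw [← hH, ← hH, key, key]
  exact (hf.contDiffAt.isSymmSndFDerivAt (by simp)) v u

lemma aux_step {d : ℕ} (f : (Fin d → ℝ) → ℝ)
    (g : (Fin d → ℝ) → (Fin d → ℝ))
    (H : (Fin d → ℝ) → Matrix (Fin d) (Fin d) ℝ)
    (hf : ContDiff ℝ 2 f) (hconv : ConvexOn ℝ Set.univ f)
    (hg : ∀ x v, fderiv ℝ f x v = g x ⬝ᵥ v)
    (hH : ∀ x u v, fderiv ℝ (fun z => fderiv ℝ f z u) x v = u ⬝ᵥ (H x *ᵥ v))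
    (L : ℝ) (hL : 0 < L) (y n : Fin d → ℝ) (hn : H y *ᵥ n = g y)
    (hn0 : g y = 0 → n = 0)
    (hs : ∀ x, f x ≤ f y →
      f x ≤ f y + g y ⬝ᵥ (x - y) + (L / 2) * ((H y *ᵥ (x - y)) ⬝ᵥ (x - y)))
    (γ : ℝ) (hγ0 : 0 < γ) (hγ : γ ≤ 1 / L) : f (y - γ • n) ≤ f y := by
  have hdf : Differentiable ℝ f := hf.differentiable (by norm_num)
  have hp := aux_psd f H hf hconv hH y
  have hsy := aux_symm f H hf hH y
  by_contra! hlt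
  have hpos : 0 < n ⬝ᵥ (H y *ᵥ n) := by
    refine lt_of_le_of_ne (hp n) fun h0 => ?_
    have hz : g y = 0 := by
      by_contra hne
      set w := g y with hw
      have hww : 0 < w ⬝ᵥ w := by
        refine lt_of_le_of_ne (Finset.sum_nonneg fun i _ => mul_self_nonneg _) fun h => hne ?_
        exact dotProduct_self_eq_zero.mp h.symm
      set c := w ⬝ᵥ (H y *ᵥ w)
      have hc : 0 ≤ c := hp w
      have e : ∀ s : ℝ, 0 ≤ 2 * s * (w ⬝ᵥ w) + s ^ 2 * c := by
        intro s
        have h := hp (n + s • w)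
        have h3 : n ⬝ᵥ (H y *ᵥ w) = w ⬝ᵥ w := by rw [hsy, hn]
        have h4 : n ⬝ᵥ w = 0 := by rw [h0, hn]
        simp only [mulVec_add, mulVec_smul, add_dotProduct, dotProduct_add, smul_dotProduct,
          dotProduct_smul, smul_eq_mul, hn, h3, h4] at h
        have : w ⬝ᵥ (H y *ᵥ w) = c := rfl
        rw [this] at h
        nlinarith
      have h := e (-(w ⬝ᵥ w) / (c + 1))
      have h5 : 2 * (-(w ⬝ᵥ w) / (c + 1)) * (w ⬝ᵥ w) + (-(w ⬝ᵥ w) / (c + 1)) ^ 2 * c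
        = -((w ⬝ᵥ w) ^ 2 * (c + 2)) / (c + 1) ^ 2 := by
        field_simp
        ring
      rw [h5] at h
      have : 0 < ((w ⬝ᵥ w) ^ 2 * (c + 2)) / (c + 1) ^ 2 := by positivity
      rw [neg_div] at h
      linarith
    rw [hn0 hz] at hlt
    simp at hlt
  set l := n ⬝ᵥ (H y *ᵥ n) with hl
  have hgn : g y ⬝ᵥ n = l := by rw [hl, hn, dotProduct_comm]
  have h1 : HasDerivAt (fun t : ℝ => f (y - t • n)) (-l) 0 := by
    have hline : HasDerivAt (fun t : ℝ => y - t • n) (-n) 0 := by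
      simpa using ((hasDerivAt_id (0:ℝ)).smul_const n).const_sub y
    have := (hdf (y - (0:ℝ) • n)).hasFDerivAt.comp_hasDerivAt (0:ℝ) hline
    rw [hg] at this
    simpa [Function.comp_def, hgn] using this
  have hcont : Continuous (fun t : ℝ => f (y - t • n)) :=
    hdf.continuous.comp (by fun_prop)
  have hex : ∃ s, 0 < s ∧ s < γ ∧ f (y - s • n) < f y := by
    have ht := h1.tendsto_slope_zero_right
    have e1 := ht.eventually (gt_mem_nhds (show -l < 0 by linarith))
    have e2 : ∀ᶠ s : ℝ in nhdsWithin 0 (Set.Ioi 0), s ∈ Set.Ioo 0 γ := Ioo_mem_nhdsGT hγ0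
    obtain ⟨s, hs1, hs2⟩ := (e1.and e2).exists
    refine ⟨s, hs2.1, hs2.2, ?_⟩
    simp only [zero_add, zero_smul, sub_zero, smul_eq_mul] at hs1
    have := neg_of_mul_neg_right hs1 (inv_pos.mpr hs2.1).le
    linarith
  obtain ⟨s, hs0, hsg, hsf⟩ := hex
  obtain ⟨t, ⟨ht1, ht2⟩, ht⟩ := intermediate_value_Icc hsg.le hcont.continuousOn
    (show f y ∈ Set.Icc _ _ from ⟨hsf.le, hlt.le⟩)
  simp only at ht
  have h := hs _ ht.le
  have e : y - t • n - y = (-t) • n := by module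
  rw [e, ht] at h
  have e3 : (H y *ᵥ n) ⬝ᵥ n = l := by rw [hn, hgn]
  simp only [mulVec_smul, smul_dotProduct, dotProduct_smul, smul_eq_mul, hgn, e3] at h
  have hLt : L * t ≤ 1 := by
    have := (le_div_iff₀ hL).mp (ht2.trans hγ)
    linarith
  have htp : 0 < t := by linarith
  have hm : 0 < t * l := by positivity
  nlinarith

/-- For a convex C² function `f` that is relatively smooth on the
level set `Q = {x : f(x) ≤ f(x₀)}` with constant `L̂ > 0` and has
`g(x) ∈ Range(H(x))` everywhere, the Newton iterates
`x_{k+1} = x_k − γ H(x_k)† g(x_k)` with `0 < γ ≤ 1/L̂` satisfy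
`f(x_{k+1}) ≤ f(x_k)` and `x_k ∈ Q` for all `k`. -/
theorem stmt4 {d : ℕ} (f : (Fin d → ℝ) → ℝ)
    (g : (Fin d → ℝ) → (Fin d → ℝ))
    (H : (Fin d → ℝ) → Matrix (Fin d) (Fin d) ℝ)
    (hf : ContDiff ℝ 2 f) (hconv : ConvexOn ℝ Set.univ f)
    (hg : ∀ x v, fderiv ℝ f x v = g x ⬝ᵥ v)
    (hH : ∀ x u v, fderiv ℝ (fun z => fderiv ℝ f z u) x v = u ⬝ᵥ (H x *ᵥ v))
    (x₀ : Fin d → ℝ) (Q : Set (Fin d → ℝ)) (hQ : Q = {x | f x ≤ f x₀})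
    (Lhat : ℝ) (hLhat : 0 < Lhat)
    (hsmooth : ∀ x ∈ Q, ∀ y ∈ Q,
      f x ≤ f y + g y ⬝ᵥ (x - y) + (Lhat / 2) * ((H y *ᵥ (x - y)) ⬝ᵥ (x - y)))
    (hrange : ∀ x, g x ∈ LinearMap.range (H x).mulVecLin)
    (Hdag : (Fin d → ℝ) → Matrix (Fin d) (Fin d) ℝ)
    (hdag : ∀ x, IsMoorePenrose (H x) (Hdag x))
    (γ : ℝ) (hγ0 : 0 < γ) (hγ : γ ≤ 1 / Lhat)
    (x : ℕ → Fin d → ℝ) (hx0 : x 0 = x₀)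
    (hrec : ∀ k, x (k + 1) = x k - γ • (Hdag (x k) *ᵥ g (x k))) :
    (∀ k, f (x (k + 1)) ≤ f (x k)) ∧ (∀ k, x k ∈ Q) := by
  have hstep : ∀ k, x k ∈ Q → f (x (k + 1)) ≤ f (x k) := by
    intro k hk
    rw [hrec k]
    have hk' : f (x k) ≤ f x₀ := by rw [hQ] at hk; exact hk
    refine aux_step f g H hf hconv hg hH Lhat hLhat (x k) _ ?_ ?_ ?_ γ hγ0 hγ
    · obtain ⟨u, hu⟩ := hrange (x k)
      rw [mulVecLin_apply] at hu
      rw [← hu, mulVec_mulVec, mulVec_mulVec, (hdag (x k)).1]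
    · intro h
      rw [h, mulVec_zero]
    · intro z hz
      exact hsmooth z (by rw [hQ]; exact hz.trans hk') (x k) hk
  have hmem : ∀ k, x k ∈ Q := by
    intro k
    induction k with
    | zero => rw [hQ, hx0]; exact le_refl (f x₀)
    | succ k ih =>
      have h := hstep k ih
      rw [hQ] at ih ⊢
      exact h.trans ih
  exact ⟨fun k => hstep k (hmem k), hmem⟩
end

section
/- Let f : ℝ^d → ℝ be convex and twice continuously differentiable with gradient g and Hessian H, let Q = {x : f(x) ≤ f(x₀)}, let f be relatively smooth on Q with constant L̂ > 0, and suppose g(x) ∈ Range(H(x)) for all x. Let x ∈ Q and let S ∈ ℝ^{d×s} satisfy Null(SᵀH(x)S) = Null(S). Then the randomized subspace Newton update x⁺ = x − (1/L̂) S (SᵀH(x)S)† Sᵀ g(x) satisfies f(x⁺) ≤ f(x), and in particular x⁺ ∈ Q. -/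
open Matrix

lemma mp_comm {n : ℕ} (W D : Matrix (Fin n) (Fin n) ℝ) (hW : Wᵀ = W)
    (h : IsMoorePenrose W D) : Dᵀ * W * D = D := by
  obtain ⟨h1, h2, h3, h4⟩ := h
  have e1 : W * (W * D) = W := by
    have := congrArg Matrix.transpose h1
    rwa [Matrix.transpose_mul, h3, hW] at this
  have e2 : D * W * W = W := by
    have : W * (D * W) = W := by rw [← Matrix.mul_assoc]; exact h1
    have := congrArg Matrix.transpose this
    rwa [Matrix.transpose_mul, h4, hW] at this
  have e3 : W * D = D * W := by
    calc W * D = D * W * W * D := by rw [e2]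
      _ = D * (W * (W * D)) := by simp only [Matrix.mul_assoc]
      _ = D * W := by rw [e1]
  have e4 : Dᵀ * W = W * D := by
    rw [Matrix.transpose_mul, hW] at h3; exact h3
  rw [e4, e3, h2]

lemma line_deriv {d : ℕ} (f : (Fin d → ℝ) → ℝ) (hf : ContDiff ℝ 2 f) (x u : Fin d → ℝ) (t : ℝ) :
    HasDerivAt (fun t : ℝ => f (x + t • u)) (fderiv ℝ f (x + t • u) u) t := by
  have h1 : HasFDerivAt f (fderiv ℝ f (x + t • u)) (x + t • u) :=
    (hf.differentiable (by norm_num) _).hasFDerivAt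
  have h2 : HasDerivAt (fun t : ℝ => x + t • u) u t := by
    simpa using ((hasDerivAt_id t).smul_const u).const_add x
  exact h1.comp_hasDerivAt t h2

lemma hess_nonneg {d : ℕ} (f : (Fin d → ℝ) → ℝ) (hf : ContDiff ℝ 2 f)
    (hconv : ConvexOn ℝ Set.univ f) (x u : Fin d → ℝ) :
    0 ≤ fderiv ℝ (fun z => fderiv ℝ f z u) x u := by
  have hc : ConvexOn ℝ Set.univ (fun t : ℝ => f (x + t • u)) := by
    have := hconv.comp_affineMap (AffineMap.lineMap x (x + u) : ℝ →ᵃ[ℝ] (Fin d → ℝ))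
    have e : (f ∘ (AffineMap.lineMap x (x + u) : ℝ →ᵃ[ℝ] (Fin d → ℝ)))
        = fun t : ℝ => f (x + t • u) := by
      funext t
      simp [AffineMap.lineMap_apply, add_comm]
    rw [e] at this
    exact this
  have hm : Monotone (fun t : ℝ => fderiv ℝ f (x + t • u) u) := by
    have := hc.monotoneOn_deriv (fun t _ => (line_deriv f hf x u t).differentiableAt)
    have e : deriv (fun t : ℝ => f (x + t • u)) = fun t : ℝ => fderiv ℝ f (x + t • u) u :=
      funext fun t => (line_deriv f hf x u t).deriv
    rw [e] at this
    exact monotoneOn_univ.mp this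
  have hd : Differentiable ℝ (fun z => fderiv ℝ f z u) := by
    have : ContDiff ℝ 1 (fderiv ℝ f) := hf.fderiv_right (by norm_num)
    exact (this.differentiable (by norm_num)).clm_apply (differentiable_const u)
  have h2 : HasDerivAt (fun t : ℝ => x + t • u) u 0 := by
    simpa using ((hasDerivAt_id (0:ℝ)).smul_const u).const_add x
  have h1 : HasFDerivAt (fun z => fderiv ℝ f z u)
      (fderiv ℝ (fun z => fderiv ℝ f z u) x) (x + (0:ℝ) • u) := by
    have := (hd (x + (0:ℝ) • u)).hasFDerivAt
    rw [zero_smul, add_zero] at this ⊢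
    exact this
  have h3 := h1.comp_hasDerivAt (0:ℝ) h2
  rw [← h3.deriv]
  exact hm.deriv_nonneg

lemma hess_symm {d : ℕ} (f : (Fin d → ℝ) → ℝ) (hf : ContDiff ℝ 2 f) (x u v : Fin d → ℝ) :
    fderiv ℝ (fun z => fderiv ℝ f z u) x v = fderiv ℝ (fun z => fderiv ℝ f z v) x u := by
  have hd : DifferentiableAt ℝ (fderiv ℝ f) x := by
    have : ContDiff ℝ 1 (fderiv ℝ f) := hf.fderiv_right (by norm_num)
    exact this.differentiable (by norm_num) x
  have key : ∀ w y, fderiv ℝ (fun z => fderiv ℝ f z w) x y = fderiv ℝ (fderiv ℝ f) x y w := by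
    intro w y
    rw [fderiv_clm_apply hd (differentiableAt_const w)]
    simp
  rw [key, key]
  exact (hf.contDiffAt.isSymmSndFDerivAt (by simp)) v u

lemma descent {d : ℕ} (f : (Fin d → ℝ) → ℝ) (hf : ContDiff ℝ 2 f) (x h : Fin d → ℝ)
    (L a : ℝ) (hL : 0 < L) (ha : 0 < a) (hd : fderiv ℝ f x h = -a)
    (hs : ∀ t : ℝ, f (x + t • h) ≤ f x → f (x + t • h) ≤ f x - t * a + L / 2 * (t ^ 2 * a)) :
    f (x + L⁻¹ • h) ≤ f x := by
  by_contra! hcon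
  have hder := line_deriv f hf x h 0
  rw [zero_smul, add_zero, hd] at hder
  have hLi : 0 < L⁻¹ := inv_pos.mpr hL
  obtain ⟨t0, ht0, htL, hlt⟩ : ∃ t0 : ℝ, 0 < t0 ∧ t0 < L⁻¹ ∧ f (x + t0 • h) < f x := by
    have hsl := (hasDerivAt_iff_tendsto_slope.mp hder).mono_left
      (nhdsWithin_mono (0:ℝ) (s := Set.Ioi 0) (fun y hy => ne_of_gt hy))
    have hev := hsl.eventually (gt_mem_nhds (show -a < 0 by linarith))
    have hev2 : ∀ᶠ t : ℝ in nhdsWithin 0 (Set.Ioi 0), t ∈ Set.Ioo 0 L⁻¹ :=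
      Ioo_mem_nhdsGT hLi
    obtain ⟨t, h1, h2⟩ := (hev.and hev2).exists
    refine ⟨t, h2.1, h2.2, ?_⟩
    rw [slope_def_field] at h1
    simp only [zero_smul, add_zero, sub_zero] at h1
    have := (div_neg_iff.mp h1)
    rcases this with h | h
    · linarith [h2.1]
    · linarith
  have hcont : Continuous (fun t : ℝ => f (x + t • h)) :=
    continuous_iff_continuousAt.mpr fun t => (line_deriv f hf x h t).continuousAt
  obtain ⟨T, hT, hTe⟩ := intermediate_value_Icc htL.le hcont.continuousOn
    (show f x ∈ Set.Icc (f (x + t0 • h)) (f (x + L⁻¹ • h)) from ⟨hlt.le, hcon.le⟩)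
  simp only at hTe
  have h1 := hs T hTe.le
  rw [hTe] at h1
  have hTp : 0 < T := lt_of_lt_of_le ht0 hT.1
  have h2 : L * T ≤ 1 := by
    calc L * T ≤ L * L⁻¹ := by gcongr; exact hT.2
      _ = 1 := mul_inv_cancel₀ hL.ne'
  have h3 : 0 < T * a := mul_pos hTp ha
  nlinarith

/-- For a convex C² function `f`, relatively smooth on the level
set `Q = {x : f(x) ≤ f(x₀)}` with constant `L̂ > 0` and with
`g(x) ∈ Range(H(x))` everywhere, if `x ∈ Q` and the sketch `S ∈ ℝ^{d×s}`
satisfies `Null(SᵀH(x)S) = Null(S)`, then the randomized subspace Newton update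
`x⁺ = x − (1/L̂) S (SᵀH(x)S)† Sᵀ g(x)` satisfies `f(x⁺) ≤ f(x)`, and `x⁺ ∈ Q`. -/
theorem stmt6 {d s : ℕ} (f : (Fin d → ℝ) → ℝ)
    (g : (Fin d → ℝ) → (Fin d → ℝ))
    (H : (Fin d → ℝ) → Matrix (Fin d) (Fin d) ℝ)
    (hf : ContDiff ℝ 2 f) (hconv : ConvexOn ℝ Set.univ f)
    (hg : ∀ x v, fderiv ℝ f x v = g x ⬝ᵥ v)
    (hH : ∀ x u v, fderiv ℝ (fun z => fderiv ℝ f z u) x v = u ⬝ᵥ (H x *ᵥ v))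
    (x₀ : Fin d → ℝ) (Q : Set (Fin d → ℝ)) (hQ : Q = {x | f x ≤ f x₀})
    (Lhat : ℝ) (hLhat : 0 < Lhat)
    (hsmooth : ∀ x ∈ Q, ∀ y ∈ Q,
      f x ≤ f y + g y ⬝ᵥ (x - y) + (Lhat / 2) * ((H y *ᵥ (x - y)) ⬝ᵥ (x - y)))
    (hrange : ∀ x, g x ∈ LinearMap.range (H x).mulVecLin)
    (x : Fin d → ℝ) (hx : x ∈ Q)
    (S : Matrix (Fin d) (Fin s) ℝ)
    (hnull : LinearMap.ker (Sᵀ * H x * S).mulVecLin = LinearMap.ker S.mulVecLin)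
    (Wdag : Matrix (Fin s) (Fin s) ℝ) (hdag : IsMoorePenrose (Sᵀ * H x * S) Wdag) :
    f (x - Lhat⁻¹ • ((S * Wdag * Sᵀ) *ᵥ g x)) ≤ f x ∧
    x - Lhat⁻¹ • ((S * Wdag * Sᵀ) *ᵥ g x) ∈ Q := by
  have hxs : f x ≤ f x₀ := by rw [hQ] at hx; exact hx
  suffices hmain : f (x - Lhat⁻¹ • ((S * Wdag * Sᵀ) *ᵥ g x)) ≤ f x by
    refine ⟨hmain, ?_⟩
    rw [hQ]
    exact hmain.trans hxs
  have hHs : (H x)ᵀ = H x := by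
    ext i j
    have := hess_symm f hf x (Pi.single i 1) (Pi.single j 1)
    rw [hH, hH] at this
    simp at this
    simp [this]
  have hHp : (H x).PosSemidef := by
    refine Matrix.PosSemidef.of_dotProduct_mulVec_nonneg ?_ ?_
    · rw [Matrix.IsHermitian, Matrix.conjTranspose_eq_transpose_of_trivial, hHs]
    · intro u
      have := hess_nonneg f hf hconv x u
      rw [hH] at this
      simpa using this
  set W := Sᵀ * H x * S with hWdef
  have hWp : W.PosSemidef := by
    have := hHp.conjTranspose_mul_mul_same S
    simpa using this
  have hWs : Wᵀ = W := by
    rw [hWdef]; simp [Matrix.transpose_mul, hHs, Matrix.mul_assoc]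
  have hmp := mp_comm W Wdag hWs hdag
  set u := Sᵀ *ᵥ g x with hu
  set l := Wdag *ᵥ u with hl
  have hstep : (S * Wdag * Sᵀ) *ᵥ g x = S *ᵥ l := by
    simp [hl, hu, Matrix.mulVec_mulVec, Matrix.mul_assoc]
  have ha1 : g x ⬝ᵥ (S *ᵥ l) = u ⬝ᵥ l := by
    rw [Matrix.dotProduct_mulVec, hu, Matrix.mulVec_transpose]
  have ha2 : l ⬝ᵥ (W *ᵥ l) = u ⬝ᵥ l := by
    have : l ⬝ᵥ (W *ᵥ l) = u ⬝ᵥ ((Wdagᵀ * W * Wdag) *ᵥ u) := by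
      rw [← Matrix.mulVec_mulVec u (Wdagᵀ * W), ← Matrix.mulVec_mulVec _ Wdagᵀ W, ← hl,
        Matrix.dotProduct_mulVec u,
        Matrix.vecMul_transpose, ← hl]
    rw [this, hmp]
  have ha3 : (H x *ᵥ (S *ᵥ l)) ⬝ᵥ (S *ᵥ l) = u ⬝ᵥ l := by
    rw [← ha2, hWdef, ← Matrix.mulVec_mulVec, ← Matrix.mulVec_mulVec, Matrix.dotProduct_mulVec l,
      Matrix.vecMul_transpose, dotProduct_comm]
  rw [hstep]
  have hann : 0 ≤ u ⬝ᵥ l := by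
    have := hWp.dotProduct_mulVec_nonneg l
    simpa [ha2] using this
  rcases hann.eq_or_lt with h0 | hpos
  · have hWl : W *ᵥ l = 0 := by
      rw [← hWp.dotProduct_mulVec_zero_iff]
      simp [ha2, ← h0]
    have hSl : S *ᵥ l = 0 := by
      have : l ∈ LinearMap.ker W.mulVecLin := by simpa using hWl
      rw [hnull] at this
      simpa using this
    simp [hSl]
  · have := descent f hf x (-(S *ᵥ l)) Lhat (u ⬝ᵥ l) hLhat hpos
      (by rw [hg, dotProduct_neg, ha1]) ?_
    · simpa [sub_eq_add_neg] using this
    · intro t ht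
      have hy : x + t • -(S *ᵥ l) ∈ Q := by rw [hQ]; exact ht.trans hxs
      have h1 := hsmooth _ hy x hx
      have e : x + t • -(S *ᵥ l) - x = (-t) • (S *ᵥ l) := by
        simp
      rw [e, dotProduct_smul, ha1, Matrix.mulVec_smul, smul_dotProduct, dotProduct_smul, ha3] at h1
      simp only [smul_eq_mul] at h1
      linarith
end

section
/- Let H ∈ ℝ^{d×d} be symmetric positive semidefinite, g ∈ Range(H), S ∈ ℝ^{d×s}, and define P := S(SᵀHS)†SᵀH and the Newton direction n := −H†g. Then P is an oblique projection with respect to the seminorm induced by H, i.e., ⟨HPx, Py⟩ = ⟨HPx, y⟩ for all x, y ∈ ℝ^d, and moreover P·n = −S(SᵀHS)†Sᵀg. Consequently the randomized subspace Newton step x⁺ = x − (1/L̂)S(SᵀHS)†Sᵀg equals x + (1/L̂)P·n for any L̂ > 0. -/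
open Matrix

/-- The Moore–Penrose inverse of a symmetric matrix is symmetric. -/
theorem mp_symm_aux {n : ℕ} (W X : Matrix (Fin n) (Fin n) ℝ) (hW : Wᵀ = W)
    (h : IsMoorePenrose W X) : Xᵀ = X := by
  obtain ⟨h1, h2, h3, h4⟩ := h
  have h3t : Xᵀ * W = W * X := by rw [← h3, transpose_mul, hW]
  have h4t : W * Xᵀ = X * W := by rw [← h4, transpose_mul, hW]
  have h1t : W * Xᵀ * W = W := by
    have := congrArg transpose h1
    simpa [transpose_mul, hW, Matrix.mul_assoc] using this
  have h2t : Xᵀ * W * Xᵀ = Xᵀ := by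
    have := congrArg transpose h2
    simpa [transpose_mul, hW, Matrix.mul_assoc] using this
  have e : W * X = X * W := by
    calc W * X = (W * Xᵀ * W) * X := by rw [h1t]
      _ = (X * W) * (W * X) := by rw [h4t, Matrix.mul_assoc]
      _ = ((W * X) * (X * W))ᵀ := by rw [transpose_mul, h3, h4]
      _ = ((W * X) * (W * Xᵀ))ᵀ := by rw [h4t]
      _ = ((W * X * W) * Xᵀ)ᵀ := by simp only [Matrix.mul_assoc]
      _ = X * W := by rw [h1, h4t, h4]
  calc Xᵀ = Xᵀ * W * Xᵀ := h2t.symm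
    _ = X * W * Xᵀ := by rw [h3t, e]
    _ = X * (W * Xᵀ) := Matrix.mul_assoc _ _ _
    _ = X * (W * X) := by rw [h4t, e]
    _ = X := by rw [← Matrix.mul_assoc, h2]

/-- Let `H` be symmetric psd, `g ∈ Range(H)`, `S ∈ ℝ^{d×s}`,
`P = S(SᵀHS)†SᵀH` and `n = −H†g`. Then `P` is an oblique projection w.r.t. the
seminorm induced by `H` (i.e. `⟨HPx, Py⟩ = ⟨HPx, y⟩` for all `x, y`), and
`P·n = −S(SᵀHS)†Sᵀg`; consequently the randomized subspace Newton step
`x − (1/L̂)S(SᵀHS)†Sᵀg` equals `x + (1/L̂)P·n` for any `L̂ > 0`. -/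
theorem stmt7 {d s : ℕ} (H : Matrix (Fin d) (Fin d) ℝ) (hH : H.PosSemidef)
    (g : Fin d → ℝ) (hg : g ∈ LinearMap.range H.mulVecLin)
    (S : Matrix (Fin d) (Fin s) ℝ)
    (Hdag : Matrix (Fin d) (Fin d) ℝ) (hHdag : IsMoorePenrose H Hdag)
    (Wdag : Matrix (Fin s) (Fin s) ℝ) (hWdag : IsMoorePenrose (Sᵀ * H * S) Wdag)
    (P : Matrix (Fin d) (Fin d) ℝ) (hP : P = S * Wdag * Sᵀ * H)
    (n : Fin d → ℝ) (hn : n = -(Hdag *ᵥ g)) :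
    (∀ x y : Fin d → ℝ, (H *ᵥ (P *ᵥ x)) ⬝ᵥ (P *ᵥ y) = (H *ᵥ (P *ᵥ x)) ⬝ᵥ y) ∧
    P *ᵥ n = -((S * Wdag * Sᵀ) *ᵥ g) ∧
    (∀ Lhat : ℝ, 0 < Lhat → ∀ x : Fin d → ℝ,
      x - Lhat⁻¹ • ((S * Wdag * Sᵀ) *ᵥ g) = x + Lhat⁻¹ • (P *ᵥ n)) := by
  have hHt : Hᵀ = H := by simpa [conjTranspose_eq_transpose_of_trivial] using hH.isHermitian.eq
  have hWt : (Sᵀ * H * S)ᵀ = Sᵀ * H * S := by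
    simp [transpose_mul, hHt, Matrix.mul_assoc]
  have hX : Wdagᵀ = Wdag := mp_symm_aux _ _ hWt hWdag
  have hPP : (H * P)ᵀ * P = (H * P)ᵀ := by
    have e : (H * P)ᵀ = H * S * Wdag * Sᵀ * H := by
      rw [hP]; simp [transpose_mul, hHt, hX, Matrix.mul_assoc]
    rw [e, hP]
    calc H * S * Wdag * Sᵀ * H * (S * Wdag * Sᵀ * H)
        = H * S * (Wdag * (Sᵀ * H * S) * Wdag) * Sᵀ * H := by simp only [Matrix.mul_assoc]
      _ = _ := by rw [hWdag.2.1]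
  have hPn : P *ᵥ n = -((S * Wdag * Sᵀ) *ᵥ g) := by
    obtain ⟨v, rfl⟩ := hg
    rw [hn, hP, mulVec_neg, mulVecLin_apply, mulVec_mulVec, mulVec_mulVec, mulVec_mulVec]
    have : S * Wdag * Sᵀ * H * (Hdag * H) = S * Wdag * Sᵀ * H := by
      rw [Matrix.mul_assoc (S * Wdag * Sᵀ), ← Matrix.mul_assoc H, hHdag.1]
    rw [Matrix.mul_assoc _ Hdag H, this]
  refine ⟨fun x y => ?_, hPn, fun L _ x => ?_⟩
  · have e : H *ᵥ (P *ᵥ x) = x ᵥ* (H * P)ᵀ := by rw [vecMul_transpose, mulVec_mulVec]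
    rw [e, dotProduct_mulVec, vecMul_vecMul, hPP]
  · rw [hPn, smul_neg, sub_eq_add_neg]
end

section
/- Let f : ℝ^d → ℝ be convex and twice continuously differentiable with gradient g and Hessian H, let L̂ > 0, let x_k ∈ ℝ^d, and let S ∈ ℝ^{d×s} satisfy Null(SᵀH(x_k)S) = Null(S). Then every λ_k ∈ argmin_{λ ∈ ℝ^s} T(x_k + Sλ, x_k), where T(x, y) := f(y) + ⟨g(y), x−y⟩ + (L̂/2)‖x−y‖²_{H(y)}, satisfies x_k + Sλ_k = x_k − (1/L̂)S(SᵀH(x_k)S)†Sᵀg(x_k), and the minimum value satisfies T(x_k + Sλ_k, x_k) = f(x_k) − (1/(2L̂))·⟨S(SᵀH(x_k)S)†Sᵀ g(x_k), g(x_k)⟩. -/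
open Matrix

/-- For a convex C² function `f` (gradient `g`, Hessian `H`),
`L̂ > 0`, `x_k ∈ ℝ^d`, and a sketch `S` with `Null(SᵀH(x_k)S) = Null(S)`, every
minimizer `λ_k` of `λ ↦ T(x_k + Sλ, x_k)` satisfies
`x_k + Sλ_k = x_k − (1/L̂)S(SᵀH(x_k)S)†Sᵀg(x_k)`, and the minimal value is
`T(x_k + Sλ_k, x_k) = f(x_k) − (1/(2L̂))⟨S(SᵀH(x_k)S)†Sᵀ g(x_k), g(x_k)⟩`. -/
theorem stmt8 {d s : ℕ} (f : (Fin d → ℝ) → ℝ)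
    (g : (Fin d → ℝ) → (Fin d → ℝ))
    (H : (Fin d → ℝ) → Matrix (Fin d) (Fin d) ℝ)
    (hf : ContDiff ℝ 2 f) (hconv : ConvexOn ℝ Set.univ f)
    (hg : ∀ x v, fderiv ℝ f x v = g x ⬝ᵥ v)
    (hH : ∀ x u v, fderiv ℝ (fun z => fderiv ℝ f z u) x v = u ⬝ᵥ (H x *ᵥ v))
    (Lhat : ℝ) (hLhat : 0 < Lhat)
    (xk : Fin d → ℝ)
    (S : Matrix (Fin d) (Fin s) ℝ)
    (hnull : LinearMap.ker (Sᵀ * H xk * S).mulVecLin = LinearMap.ker S.mulVecLin)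
    (Wdag : Matrix (Fin s) (Fin s) ℝ) (hdag : IsMoorePenrose (Sᵀ * H xk * S) Wdag)
    (T : (Fin d → ℝ) → ℝ)
    (hT : ∀ x, T x = f xk + g xk ⬝ᵥ (x - xk) +
      (Lhat / 2) * ((H xk *ᵥ (x - xk)) ⬝ᵥ (x - xk)))
    (lam : Fin s → ℝ) (hlam : ∀ l : Fin s → ℝ, T (xk + S *ᵥ lam) ≤ T (xk + S *ᵥ l)) :
    xk + S *ᵥ lam = xk - Lhat⁻¹ • ((S * Wdag * Sᵀ) *ᵥ g xk) ∧
    T (xk + S *ᵥ lam) =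
      f xk - (1 / (2 * Lhat)) * (((S * Wdag * Sᵀ) *ᵥ g xk) ⬝ᵥ g xk) := by
  have hsymm : ∀ u v : Fin d → ℝ, u ⬝ᵥ (H xk *ᵥ v) = v ⬝ᵥ (H xk *ᵥ u) := by
    have hs : IsSymmSndFDerivAt ℝ f xk :=
      hf.contDiffAt.isSymmSndFDerivAt (by simp)
    have hd : DifferentiableAt ℝ (fderiv ℝ f) xk :=
      ((hf.fderiv_right (m := 1) (by norm_num)).differentiable (by norm_num)) xk
    have key : ∀ u v : Fin d → ℝ, u ⬝ᵥ (H xk *ᵥ v) = fderiv ℝ (fderiv ℝ f) xk v u := by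
      intro u v
      rw [← hH xk u v, fderiv_clm_apply hd (differentiableAt_const u)]
      simp
    intro u v
    rw [key, key]
    exact hs v u
  obtain ⟨h1, -, -, -⟩ := hdag
  have lin : ∀ a c : ℝ, (∀ t : ℝ, 0 ≤ t * a + t ^ 2 * c) → a = 0 := by
    intro a c h
    by_contra ha
    have hc : 0 < |c| + 1 := by positivity
    have h2 := h (-a / (|c| + 1))
    have h3 : -a / (|c| + 1) * a + (-a / (|c| + 1)) ^ 2 * c
        = a ^ 2 / (|c| + 1) ^ 2 * (c - (|c| + 1)) := by
      field_simp
      ring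
    rw [h3] at h2
    have h4 : 0 < a ^ 2 / (|c| + 1) ^ 2 := by positivity
    have h5 : c - (|c| + 1) < 0 := by linarith [le_abs_self c]
    nlinarith [mul_neg_of_pos_of_neg h4 h5]
  have foc : ∀ v : Fin s → ℝ,
      g xk ⬝ᵥ (S *ᵥ v) + Lhat * ((S *ᵥ v) ⬝ᵥ (H xk *ᵥ (S *ᵥ lam))) = 0 := by
    intro v
    apply lin _ (Lhat / 2 * ((S *ᵥ v) ⬝ᵥ (H xk *ᵥ (S *ᵥ v))))
    intro t
    have h := hlam (lam + t • v)
    rw [hT, hT] at h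
    simp only [add_sub_cancel_left, mulVec_add, mulVec_smul, dotProduct_add, add_dotProduct,
      dotProduct_smul, smul_dotProduct, smul_eq_mul] at h
    rw [dotProduct_comm (H xk *ᵥ S *ᵥ lam) (S *ᵥ v), dotProduct_comm (H xk *ᵥ S *ᵥ v) (S *ᵥ lam),
      hsymm (S *ᵥ lam) (S *ᵥ v), dotProduct_comm (H xk *ᵥ S *ᵥ v) (S *ᵥ v)] at h
    linarith
  have hb : Sᵀ *ᵥ g xk = -(Lhat • ((Sᵀ * H xk * S) *ᵥ lam)) := by
    rw [eq_neg_iff_add_eq_zero]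
    apply dotProduct_eq_zero _
    intro v
    rw [← foc v, add_dotProduct, smul_dotProduct, smul_eq_mul, ← mulVec_mulVec, ← mulVec_mulVec,
      mulVec_transpose, mulVec_transpose, ← dotProduct_mulVec, ← dotProduct_mulVec,
      dotProduct_comm (S *ᵥ v)]
  have hker : S *ᵥ (Wdag *ᵥ ((Sᵀ * H xk * S) *ᵥ lam)) = S *ᵥ lam := by
    have hm : Wdag *ᵥ ((Sᵀ * H xk * S) *ᵥ lam) - lam ∈ LinearMap.ker S.mulVecLin := by
      rw [← hnull, LinearMap.mem_ker, mulVecLin_apply, mulVec_sub, mulVec_mulVec, mulVec_mulVec,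
        h1, sub_self]
    rw [LinearMap.mem_ker, mulVecLin_apply, mulVec_sub, sub_eq_zero] at hm
    exact hm
  have hmain : (S * Wdag * Sᵀ) *ᵥ g xk = -(Lhat • (S *ᵥ lam)) := by
    rw [← mulVec_mulVec, hb, ← mulVec_mulVec, mulVec_neg, mulVec_neg, mulVec_smul, mulVec_smul,
      hker]
  constructor
  · rw [hmain, smul_neg, smul_smul, inv_mul_cancel₀ hLhat.ne', one_smul, sub_neg_eq_add]
  · rw [hT, hmain, add_sub_cancel_left, neg_dotProduct, smul_dotProduct, smul_eq_mul,
      dotProduct_comm (H xk *ᵥ S *ᵥ lam), dotProduct_comm (S *ᵥ lam) (g xk)]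
    have h := foc lam
    have h6 : 1 / (2 * Lhat) * -(Lhat * (g xk ⬝ᵥ S *ᵥ lam)) = -(g xk ⬝ᵥ S *ᵥ lam) / 2 := by
      field_simp
    rw [h6]
    linarith
end

section
/- Let f : ℝ^d → ℝ be convex and twice continuously differentiable with gradient g and Hessian H, bounded below with minimum value f_*, let Q = {x : f(x) ≤ f(x₀)}, suppose f is relatively smooth and relatively convex on Q with constants L̂ ≥ μ̂ > 0, and suppose g(x) ∈ Range(H(x)) for all x. Let D be a probability distribution on ℝ^{d×s} such that Null(SᵀH(y)S) = Null(S) for all y ∈ Q holds D-almost surely, define G(x) := E_{S∼D}[S(SᵀH(x)S)†Sᵀ] (assumed to exist), and let ρ(x) := min_{v ∈ Range(H(x)), v≠0} ⟨H(x)^{1/2} G(x) H(x)^{1/2} v, v⟩/‖v‖². Then for every x ∈ Q, the one-step expected progress of the randomized subspace Newton update satisfies E_{S∼D}[ f( x − (1/L̂) S(SᵀH(x)S)†Sᵀ g(x) ) ] − f_* ≤ (1 − ρ(x)·μ̂/L̂)·( f(x) − f_* ). -/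
open Matrix MeasureTheory

theorem aux_nonneg {n : ℕ} (v : Fin n → ℝ) : 0 ≤ v ⬝ᵥ v :=
  Finset.sum_nonneg fun i _ => mul_self_nonneg (v i)

theorem aux_mp_symm {n : ℕ} {M A : Matrix (Fin n) (Fin n) ℝ} (hM : Mᵀ = M)
    (h : IsMoorePenrose M A) : Aᵀ = A := by
  obtain ⟨h1, h2, h3, h4⟩ := h
  have e1 : Aᵀ * M = M * A := by rw [← h3, transpose_mul, hM]
  have e2 : M * Aᵀ = A * M := by rw [← h4, transpose_mul, hM]
  have k : A * M = M * A := by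
    calc A * M = M * Aᵀ := e2.symm
      _ = (M * A * M) * Aᵀ := by rw [h1]
      _ = M * A * (M * Aᵀ) := by simp only [Matrix.mul_assoc]
      _ = M * A * (A * M) := by rw [e2]
      _ = (Aᵀ * M) * (A * M) := by rw [e1]
      _ = Aᵀ * (M * A * M) := by simp only [Matrix.mul_assoc]
      _ = M * A := by rw [h1, e1]
  have h2' : Aᵀ * M * Aᵀ = Aᵀ := by
    have := congrArg transpose h2
    simpa [transpose_mul, hM, Matrix.mul_assoc] using this
  calc Aᵀ = Aᵀ * M * Aᵀ := h2'.symm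
    _ = A * M * Aᵀ := by rw [e1, k]
    _ = A * (A * M) := by rw [Matrix.mul_assoc, e2]
    _ = A * M * A := by rw [Matrix.mul_assoc, ← k]
    _ = A := h2

theorem aux_quad {d s : ℕ} {S : Matrix (Fin d) (Fin s) ℝ} {Hm R : Matrix (Fin d) (Fin d) ℝ}
    (hR : Rᵀ = R) (hRR : R * R = Hm) {A : Matrix (Fin s) (Fin s) ℝ}
    (h : IsMoorePenrose (Sᵀ * Hm * S) A) (u : Fin d → ℝ) :
    u ⬝ᵥ ((S * A * Sᵀ) *ᵥ u) = (R *ᵥ ((S * A * Sᵀ) *ᵥ u)) ⬝ᵥ (R *ᵥ ((S * A * Sᵀ) *ᵥ u)) := by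
  have hHt : Hmᵀ = Hm := by rw [← hRR, transpose_mul, hR]
  have hM : (Sᵀ * Hm * S)ᵀ = Sᵀ * Hm * S := by
    simp [transpose_mul, hHt, Matrix.mul_assoc]
  have hA := aux_mp_symm hM h
  have hB : (S * A * Sᵀ)ᵀ = S * A * Sᵀ := by simp [transpose_mul, hA, Matrix.mul_assoc]
  have key : (S * A * Sᵀ) * Hm * (S * A * Sᵀ) = S * A * Sᵀ := by
    conv_rhs => rw [← h.2.1]
    simp only [Matrix.mul_assoc]
  rw [Matrix.dotProduct_mulVec, Matrix.dotProduct_mulVec, ← Matrix.mulVec_transpose,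
    ← Matrix.mulVec_transpose, hR, hB, Matrix.mulVec_mulVec, hRR]
  conv_rhs => rw [Matrix.dotProduct_mulVec, ← Matrix.mulVec_transpose, hB, Matrix.mulVec_mulVec,
    Matrix.mulVec_mulVec, key]

theorem aux_range {d : ℕ} {Hm R : Matrix (Fin d) (Fin d) ℝ}
    (hR : Rᵀ = R) (hRR : R * R = Hm) :
    LinearMap.range R.mulVecLin = LinearMap.range Hm.mulVecLin := by
  symm
  apply Submodule.eq_of_le_of_finrank_eq
  · rintro _ ⟨w, rfl⟩
    exact ⟨R *ᵥ w, by simp [← hRR]⟩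
  · have := Matrix.rank_transpose_mul_self R
    rw [hR, hRR] at this
    exact this

theorem aux_descent {d : ℕ} (f : (Fin d → ℝ) → ℝ) (hf : ContDiff ℝ 2 f) (gx x p : Fin d → ℝ)
    (hg : ∀ v, fderiv ℝ f x v = gx ⬝ᵥ v) (c L q : ℝ) (hL : 0 < L) (hxc : f x ≤ c)
    (hgp : gx ⬝ᵥ p = q) (hq : 0 < q)
    (hsm : ∀ t, f (x - t • p) ≤ c → f (x - t • p) ≤ f x - t * q + L / 2 * (t ^ 2 * q)) :
    f (x - L⁻¹ • p) ≤ c := by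
  by_contra! hcon
  have hc : Continuous fun t : ℝ => f (x - t • p) := hf.continuous.comp (by fun_prop)
  have hd : HasDerivAt (fun t : ℝ => f (x - t • p)) (-q) 0 := by
    have h1 : HasDerivAt (fun t : ℝ => x - t • p) (-p) 0 := by
      simpa using ((hasDerivAt_id (0:ℝ)).smul_const p).const_sub x
    have h2 : HasFDerivAt f (fderiv ℝ f x) (x - (0:ℝ) • p) := by
      simpa using (hf.differentiable (by norm_num) x).hasFDerivAt
    have h3 := h2.comp_hasDerivAt (0:ℝ) h1
    rw [hg] at h3
    rw [dotProduct_neg, hgp] at h3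
    exact h3
  have hLi : 0 < L⁻¹ := by positivity
  have hs := hasDerivAt_iff_tendsto_slope.1 hd
  have hs2 : Filter.Tendsto (slope (fun t : ℝ => f (x - t • p)) 0) (nhdsWithin 0 (Set.Ioi 0))
      (nhds (-q)) := hs.mono_left (nhdsWithin_mono _ (fun t ht => ne_of_gt ht))
  have hev := hs2.eventually_lt_const (show -q < 0 by linarith)
  obtain ⟨t0, ht0, ht1⟩ := (hev.and (Ioo_mem_nhdsGT hLi)).exists
  have hlt : f (x - t0 • p) < f x := by
    rw [slope_def_field] at ht0
    have := ht1.1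
    rw [div_lt_iff₀ (by linarith)] at ht0
    simpa using ht0
  obtain ⟨t, ht, hft⟩ := intermediate_value_Icc ht1.2.le hc.continuousOn
    (show c ∈ Set.Icc _ _ from ⟨by linarith, hcon.le⟩)
  have h4 := hsm t hft.le
  simp only at hft
  have h5 : 0 < t := lt_of_lt_of_le ht1.1 ht.1
  have h6 : L * t ≤ 1 := by
    have := mul_le_mul_of_nonneg_left ht.2 hL.le
    rwa [mul_inv_cancel₀ hL.ne'] at this
  nlinarith [mul_pos h5 hq, mul_le_mul_of_nonneg_right h6 (mul_pos h5 hq).le]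

/-- One-step expected progress of randomized subspace Newton.
Sketch matrices `S ∈ ℝ^{d×s}` are modelled as elements of the (measurable) Pi
type `Fin d → Fin s → ℝ`, turned into matrices by `Matrix.of`; `D` is a
probability measure on them.  With `f` convex and C², bounded below with infimum
`f_*`, relatively smooth and relatively convex on `Q = {x : f(x) ≤ f(x₀)}` with
constants `L̂ ≥ μ̂ > 0`, `g(x) ∈ Range(H(x))` for all `x`, the nullspace
condition holding `D`-a.s., `G(x) = E[S(SᵀH(x)S)†Sᵀ]` and
`ρ(x) = min_{0 ≠ v ∈ Range H(x)} ⟨H(x)^{1/2}G(x)H(x)^{1/2}v, v⟩/‖v‖²`, one has,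
for every `x ∈ Q`,
`E[f(x − (1/L̂)S(SᵀH(x)S)†Sᵀg(x))] − f_* ≤ (1 − ρ(x)μ̂/L̂)(f(x) − f_*)`. -/
theorem stmt12 {d s : ℕ} (f : (Fin d → ℝ) → ℝ)
    (g : (Fin d → ℝ) → (Fin d → ℝ))
    (H : (Fin d → ℝ) → Matrix (Fin d) (Fin d) ℝ)
    (hf : ContDiff ℝ 2 f) (hconv : ConvexOn ℝ Set.univ f)
    (hg : ∀ x v, fderiv ℝ f x v = g x ⬝ᵥ v)
    (hH : ∀ x u v, fderiv ℝ (fun z => fderiv ℝ f z u) x v = u ⬝ᵥ (H x *ᵥ v))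
    (fstar : ℝ) (hfstar : IsGLB (Set.range f) fstar)
    (x₀ : Fin d → ℝ) (Q : Set (Fin d → ℝ)) (hQ : Q = {x | f x ≤ f x₀})
    (Lhat μhat : ℝ) (hμhat : 0 < μhat) (hμL : μhat ≤ Lhat)
    (hsmooth : ∀ x ∈ Q, ∀ y ∈ Q,
      f x ≤ f y + g y ⬝ᵥ (x - y) + (Lhat / 2) * ((H y *ᵥ (x - y)) ⬝ᵥ (x - y)))
    (hrelconv : ∀ x ∈ Q, ∀ y ∈ Q,
      f y + g y ⬝ᵥ (x - y) + (μhat / 2) * ((H y *ᵥ (x - y)) ⬝ᵥ (x - y)) ≤ f x)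
    (hrange : ∀ x, g x ∈ LinearMap.range (H x).mulVecLin)
    (Hsqrt : (Fin d → ℝ) → Matrix (Fin d) (Fin d) ℝ)
    (hsqrt : ∀ x, (Hsqrt x).PosSemidef ∧ Hsqrt x * Hsqrt x = H x)
    (D : Measure (Fin d → Fin s → ℝ)) [IsProbabilityMeasure D]
    (pinv : Matrix (Fin s) (Fin s) ℝ → Matrix (Fin s) (Fin s) ℝ)
    (hpinv : ∀ M, IsMoorePenrose M (pinv M))
    (hnull : ∀ᵐ S ∂D, ∀ y ∈ Q,
      LinearMap.ker ((Matrix.of S)ᵀ * H y * Matrix.of S).mulVecLin =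
        LinearMap.ker (Matrix.of S).mulVecLin)
    (G : (Fin d → ℝ) → Matrix (Fin d) (Fin d) ℝ)
    (hGint : ∀ x i j, Integrable (fun S : Fin d → Fin s → ℝ =>
      (Matrix.of S * pinv ((Matrix.of S)ᵀ * H x * Matrix.of S) * (Matrix.of S)ᵀ) i j) D)
    (hG : ∀ x i j, G x i j =
      ∫ S, (Matrix.of S * pinv ((Matrix.of S)ᵀ * H x * Matrix.of S) * (Matrix.of S)ᵀ) i j ∂D)
    (ρ : (Fin d → ℝ) → ℝ)
    (hρ : ∀ x, ρ x = sInf {r : ℝ | ∃ v ∈ LinearMap.range (H x).mulVecLin,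
      v ≠ 0 ∧ r = ((Hsqrt x * G x * Hsqrt x) *ᵥ v) ⬝ᵥ v / (v ⬝ᵥ v)})
    (x : Fin d → ℝ) (hx : x ∈ Q)
    (hfint : Integrable (fun S : Fin d → Fin s → ℝ => f (x - Lhat⁻¹ •
      ((Matrix.of S * pinv ((Matrix.of S)ᵀ * H x * Matrix.of S) * (Matrix.of S)ᵀ) *ᵥ g x))) D) :
    (∫ S, f (x - Lhat⁻¹ •
        ((Matrix.of S * pinv ((Matrix.of S)ᵀ * H x * Matrix.of S) * (Matrix.of S)ᵀ) *ᵥ g x)) ∂D)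
      - fstar ≤ (1 - ρ x * μhat / Lhat) * (f x - fstar) := by
  have hL : 0 < Lhat := lt_of_lt_of_le hμhat hμL
  obtain ⟨hRp, hRR⟩ := hsqrt x
  have hR : (Hsqrt x)ᵀ = Hsqrt x := by
    have := hRp.isHermitian.eq
    rwa [conjTranspose_eq_transpose_of_trivial] at this
  have hxc : f x ≤ f x₀ := by rw [hQ] at hx; exact hx
  have hHq : ∀ z, (H x *ᵥ z) ⬝ᵥ z = (Hsqrt x *ᵥ z) ⬝ᵥ (Hsqrt x *ᵥ z) := by
    intro z
    rw [← hRR, Matrix.dotProduct_mulVec, ← Matrix.mulVec_transpose, hR, Matrix.mulVec_mulVec]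
  have hquad : ∀ (S : Fin d → Fin s → ℝ) u, 0 ≤ u ⬝ᵥ ((Matrix.of S *
      pinv ((Matrix.of S)ᵀ * H x * Matrix.of S) * (Matrix.of S)ᵀ) *ᵥ u) := by
    intro S u
    rw [aux_quad hR hRR (hpinv _) u]
    exact aux_nonneg _
  have hform : ∀ (B : Matrix (Fin d) (Fin d) ℝ) (u : Fin d → ℝ),
      u ⬝ᵥ (B *ᵥ u) = ∑ i, ∑ j, u i * (B i j * u j) := by
    intro B u
    simp only [dotProduct, mulVec, Finset.mul_sum]
  have hint : ∀ u : Fin d → ℝ, Integrable (fun S : Fin d → Fin s → ℝ => u ⬝ᵥ ((Matrix.of S *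
      pinv ((Matrix.of S)ᵀ * H x * Matrix.of S) * (Matrix.of S)ᵀ) *ᵥ u)) D := by
    intro u
    simp only [hform]
    exact integrable_finsetSum _ fun i _ => integrable_finsetSum _ fun j _ =>
      ((hGint x i j).mul_const _).const_mul _
  have hGq : ∀ u : Fin d → ℝ, u ⬝ᵥ (G x *ᵥ u) = ∫ S, u ⬝ᵥ ((Matrix.of S *
      pinv ((Matrix.of S)ᵀ * H x * Matrix.of S) * (Matrix.of S)ᵀ) *ᵥ u) ∂D := by
    intro u
    simp only [hform]
    rw [integral_finsetSum _ fun i _ => integrable_finsetSum _ fun j _ =>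
      ((hGint x i j).mul_const _).const_mul _]
    refine Finset.sum_congr rfl fun i _ => ?_
    rw [integral_finsetSum _ fun j _ => ((hGint x i j).mul_const _).const_mul _]
    refine Finset.sum_congr rfl fun j _ => ?_
    rw [integral_const_mul, integral_mul_const, hG]
  have hGnn : ∀ u : Fin d → ℝ, 0 ≤ u ⬝ᵥ (G x *ᵥ u) := by
    intro u
    rw [hGq]
    exact integral_nonneg fun S => hquad S u
  have hGv : ∀ v : Fin d → ℝ, ((Hsqrt x * G x * Hsqrt x) *ᵥ v) ⬝ᵥ v =
      (Hsqrt x *ᵥ v) ⬝ᵥ (G x *ᵥ (Hsqrt x *ᵥ v)) := by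
    intro v
    rw [dotProduct_comm, ← Matrix.mulVec_mulVec, ← Matrix.mulVec_mulVec,
      Matrix.dotProduct_mulVec, ← Matrix.mulVec_transpose, hR]
  -- almost sure one-step descent
  have hstep : ∀ᵐ S ∂D, f (x - Lhat⁻¹ •
      ((Matrix.of S * pinv ((Matrix.of S)ᵀ * H x * Matrix.of S) * (Matrix.of S)ᵀ) *ᵥ g x)) ≤
      f x - (2 * Lhat)⁻¹ * (g x ⬝ᵥ ((Matrix.of S *
        pinv ((Matrix.of S)ᵀ * H x * Matrix.of S) * (Matrix.of S)ᵀ) *ᵥ g x)) := by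
    filter_upwards [hnull] with S hS
    have hS := hS x hx
    have hpq := aux_quad hR hRR (hpinv ((Matrix.of S)ᵀ * H x * Matrix.of S)) (g x)
    have hq0 := hquad S (g x)
    have hpS : ∃ w, (Matrix.of S * pinv ((Matrix.of S)ᵀ * H x * Matrix.of S) *
        (Matrix.of S)ᵀ) *ᵥ g x = Matrix.of S *ᵥ w :=
      ⟨(pinv ((Matrix.of S)ᵀ * H x * Matrix.of S) * (Matrix.of S)ᵀ) *ᵥ g x, by
        rw [Matrix.mulVec_mulVec, Matrix.mul_assoc]⟩
    generalize (Matrix.of S * pinv ((Matrix.of S)ᵀ * H x * Matrix.of S) *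
        (Matrix.of S)ᵀ) *ᵥ g x = p at *
    have hsm : ∀ t : ℝ, f (x - t • p) ≤ f x₀ → f (x - t • p) ≤
        f x - t * (g x ⬝ᵥ p) + Lhat / 2 * (t ^ 2 * (g x ⬝ᵥ p)) := by
      intro t ht
      have h1 := hsmooth (x - t • p) (by rw [hQ]; exact ht) x hx
      have h2 : x - t • p - x = (-t) • p := by rw [neg_smul]; abel
      rw [h2, hHq, Matrix.mulVec_smul, dotProduct_smul, dotProduct_smul, smul_dotProduct,
        ← hpq] at h1
      simp only [smul_eq_mul] at h1
      linarith
    rcases hq0.eq_or_lt with h0 | hpos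
    · have hz : Hsqrt x *ᵥ p = 0 := by
        rw [← h0] at hpq
        exact dotProduct_self_eq_zero.1 hpq.symm
      obtain ⟨w, hw⟩ := hpS
      have hwk : w ∈ LinearMap.ker ((Matrix.of S)ᵀ * H x * Matrix.of S).mulVecLin := by
        rw [LinearMap.mem_ker, Matrix.mulVecLin_apply, ← Matrix.mulVec_mulVec, ← hw, ← hRR,
          ← Matrix.mul_assoc, ← Matrix.mulVec_mulVec, hz, Matrix.mulVec_zero]
      rw [hS, LinearMap.mem_ker, Matrix.mulVecLin_apply, ← hw] at hwk
      rw [hwk]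
      simp
    · have hin := aux_descent f hf (g x) x p (hg x) (f x₀) Lhat _ hL hxc rfl hpos hsm
      refine (hsm _ hin).trans (le_of_eq ?_)
      field_simp
      ring
  have hE : (∫ S, f (x - Lhat⁻¹ •
        ((Matrix.of S * pinv ((Matrix.of S)ᵀ * H x * Matrix.of S) * (Matrix.of S)ᵀ) *ᵥ g x)) ∂D)
      ≤ f x - (2 * Lhat)⁻¹ * (g x ⬝ᵥ (G x *ᵥ g x)) := by
    refine (integral_mono_ae hfint
      ((integrable_const (f x)).sub ((hint (g x)).const_mul _)) hstep).trans (le_of_eq ?_)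
    rw [integral_sub' (integrable_const (f x)) ((hint (g x)).const_mul _), integral_const_mul,
      ← hGq]
    simp
  -- write the gradient as `Hsqrt v` with `v` in the range of `H`
  obtain ⟨v, hv, hgv⟩ : ∃ v ∈ LinearMap.range (H x).mulVecLin, g x = Hsqrt x *ᵥ v := by
    obtain ⟨w, hw⟩ := hrange x
    refine ⟨Hsqrt x *ᵥ w, ?_, ?_⟩
    · rw [← aux_range hR hRR]
      exact ⟨w, rfl⟩
    · rw [← hw, Matrix.mulVec_mulVec, hRR]; rfl
  have hlb : ∀ r ∈ {r : ℝ | ∃ v ∈ LinearMap.range (H x).mulVecLin,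
      v ≠ 0 ∧ r = ((Hsqrt x * G x * Hsqrt x) *ᵥ v) ⬝ᵥ v / (v ⬝ᵥ v)}, 0 ≤ r := by
    rintro r ⟨v, -, -, rfl⟩
    rw [hGv]
    exact div_nonneg (hGnn _) (aux_nonneg _)
  have hρ0 : 0 ≤ ρ x := by
    rw [hρ]
    exact Real.sInf_nonneg hlb
  have hρv : ρ x * (v ⬝ᵥ v) ≤ g x ⬝ᵥ (G x *ᵥ g x) := by
    by_cases hv0 : v = 0
    · rw [hv0, zero_dotProduct, mul_zero]
      exact hGnn _
    · have hpos : 0 < v ⬝ᵥ v := lt_of_le_of_ne (aux_nonneg _)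
        (fun h => hv0 (dotProduct_self_eq_zero.1 h.symm))
      have h1 : ρ x ≤ ((Hsqrt x * G x * Hsqrt x) *ᵥ v) ⬝ᵥ v / (v ⬝ᵥ v) := by
        rw [hρ]
        exact csInf_le ⟨0, hlb⟩ ⟨v, hv, hv0, rfl⟩
      rw [le_div_iff₀ hpos, hGv, ← hgv] at h1
      exact h1
  have hvv : 0 ≤ v ⬝ᵥ v := aux_nonneg _
  have hgap : f x - (2 * μhat)⁻¹ * (v ⬝ᵥ v) ≤ fstar := by
    refine hfstar.2 ?_
    rintro _ ⟨y, rfl⟩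
    by_cases hy : y ∈ Q
    · have h1 := hrelconv y hy x hx
      rw [hHq] at h1
      have h2 : g x ⬝ᵥ (y - x) = v ⬝ᵥ (Hsqrt x *ᵥ (y - x)) := by
        rw [hgv, Matrix.dotProduct_mulVec, ← Matrix.mulVec_transpose, hR]
      rw [h2] at h1
      generalize Hsqrt x *ᵥ (y - x) = z at h1
      have h3 : 0 ≤ (v + μhat • z) ⬝ᵥ (v + μhat • z) := aux_nonneg _
      simp only [add_dotProduct, dotProduct_add, smul_dotProduct, dotProduct_smul,
        smul_eq_mul, dotProduct_comm z v] at h3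
      have h4 : 0 ≤ (2 * μhat)⁻¹ * (v ⬝ᵥ v + μhat * (v ⬝ᵥ z) +
          (μhat * (v ⬝ᵥ z) + μhat * (μhat * (z ⬝ᵥ z)))) :=
        mul_nonneg (by positivity) (by linarith)
      have h5 : (2 * μhat)⁻¹ * (v ⬝ᵥ v + μhat * (v ⬝ᵥ z) +
          (μhat * (v ⬝ᵥ z) + μhat * (μhat * (z ⬝ᵥ z)))) =
          (2 * μhat)⁻¹ * (v ⬝ᵥ v) + v ⬝ᵥ z + μhat / 2 * (z ⬝ᵥ z) := by
        field_simp
        ring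
      linarith
    · rw [hQ, Set.mem_ofPred_eq, not_le] at hy
      have : 0 ≤ (2 * μhat)⁻¹ * (v ⬝ᵥ v) := by positivity
      linarith
  have h6 : ρ x * μhat / Lhat * (f x - fstar) ≤ ρ x * μhat / Lhat * ((2 * μhat)⁻¹ * (v ⬝ᵥ v)) :=
    mul_le_mul_of_nonneg_left (by linarith) (by positivity)
  have h7 : ρ x * μhat / Lhat * ((2 * μhat)⁻¹ * (v ⬝ᵥ v)) =
      (2 * Lhat)⁻¹ * (ρ x * (v ⬝ᵥ v)) := by
    field_simp
  have h8 : (2 * Lhat)⁻¹ * (ρ x * (v ⬝ᵥ v)) ≤ (2 * Lhat)⁻¹ * (g x ⬝ᵥ (G x *ᵥ g x)) :=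
    mul_le_mul_of_nonneg_left hρv (by positivity)
  linarith
end

section
/- Let f : ℝ^d → ℝ be convex and twice continuously differentiable with gradient g and Hessian H, bounded below with minimum value f_* attained on a nonempty set X_* of minimizers, let Q = {x : f(x) ≤ f(x₀)}, and suppose g(x) ∈ Range(H(x)) for all x. Let R := inf_{x_* ∈ X_*} sup_{x ∈ Q} ‖x − x_*‖_{H(x)} and assume R < +∞. Then for every x ∈ Q: f(x) − f_* ≤ R·‖g(x)‖_{H(x)†}, where ‖v‖_M := √⟨Mv, v⟩. -/
open Matrix

/-- Restriction of a function to a line. -/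
lemma line_hasDerivAt {d : ℕ} {F : (Fin d → ℝ) → ℝ} (hF : Differentiable ℝ F)
    (x v : Fin d → ℝ) (t : ℝ) :
    HasDerivAt (fun s : ℝ => F (x + s • v)) (fderiv ℝ F (x + t • v) v) t := by
  have h1 : HasDerivAt (fun s : ℝ => x + s • v) v t := by
    simpa using ((hasDerivAt_id t).smul_const v).const_add x
  exact (hF (x + t • v)).hasFDerivAt.comp_hasDerivAt t h1

lemma line_convex {d : ℕ} {f : (Fin d → ℝ) → ℝ} (hconv : ConvexOn ℝ Set.univ f)
    (x v : Fin d → ℝ) : ConvexOn ℝ Set.univ (fun s : ℝ => f (x + s • v)) := by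
  refine ⟨convex_univ, fun a _ b _ p q hp hq hpq => ?_⟩
  have := hconv.2 (Set.mem_univ (x + a • v)) (Set.mem_univ (x + b • v)) hp hq hpq
  have e : p • (x + a • v) + q • (x + b • v) = x + (p • a + q • b) • v := by
    have : x = (p + q) • x := by rw [hpq, one_smul]
    conv_rhs => rw [this]
    module
  rw [e] at this
  exact this

lemma cs_aux (a b c : ℝ) (ha : 0 ≤ a) (hc : 0 ≤ c)
    (h : ∀ t : ℝ, 0 ≤ c * (t * t) + (2 * b) * t + a) : b ≤ √c * √a := by
  have hd := discrim_le_zero h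
  rw [discrim] at hd
  rw [← Real.sqrt_mul hc]
  apply Real.le_sqrt_of_sq_le
  nlinarith

/-- Let `f` be convex and C², bounded below, attaining its
minimum value `f_*` on the nonempty set `X_*` of minimizers, with
`g(x) ∈ Range(H(x))` for all `x`, and let
`R = inf_{x_* ∈ X_*} sup_{x ∈ Q} ‖x − x_*‖_{H(x)} < ∞`
(encoded: `R` is the infimum of the nonempty set of `r` that bound
`‖x − x_*‖_{H(x)}` over `Q` for some minimizer `x_*`).  Then for every `x ∈ Q`:
`f(x) − f_* ≤ R‖g(x)‖_{H(x)†}`. -/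
theorem stmt14 {d : ℕ} (f : (Fin d → ℝ) → ℝ)
    (g : (Fin d → ℝ) → (Fin d → ℝ))
    (H : (Fin d → ℝ) → Matrix (Fin d) (Fin d) ℝ)
    (hf : ContDiff ℝ 2 f) (hconv : ConvexOn ℝ Set.univ f)
    (hg : ∀ x v, fderiv ℝ f x v = g x ⬝ᵥ v)
    (hH : ∀ x u v, fderiv ℝ (fun z => fderiv ℝ f z u) x v = u ⬝ᵥ (H x *ᵥ v))
    (Xstar : Set (Fin d → ℝ)) (hXstar : Xstar = {z | ∀ w, f z ≤ f w})
    (hXne : Xstar.Nonempty)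
    (fstar : ℝ) (hfstar : ∀ z ∈ Xstar, f z = fstar)
    (x₀ : Fin d → ℝ) (Q : Set (Fin d → ℝ)) (hQ : Q = {x | f x ≤ f x₀})
    (hrange : ∀ x, g x ∈ LinearMap.range (H x).mulVecLin)
    (Hdag : (Fin d → ℝ) → Matrix (Fin d) (Fin d) ℝ)
    (hdag : ∀ x, IsMoorePenrose (H x) (Hdag x))
    (SR : Set ℝ)
    (hSR : SR = {r : ℝ | ∃ xs ∈ Xstar, ∀ x ∈ Q,
      Real.sqrt ((H x *ᵥ (x - xs)) ⬝ᵥ (x - xs)) ≤ r})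
    (hSRne : SR.Nonempty)
    (R : ℝ) (hR : R = sInf SR) :
    ∀ x ∈ Q, f x - fstar ≤ R * Real.sqrt ((Hdag x *ᵥ g x) ⬝ᵥ g x) := by
  have hfd : Differentiable ℝ f := hf.differentiable (by norm_num)
  have hfd2 : Differentiable ℝ (fderiv ℝ f) :=
    (hf.fderiv_right (m := 1) (by norm_num)).differentiable (by norm_num)
  have happ : ∀ u, Differentiable ℝ (fun z => fderiv ℝ f z u) := fun u z =>
    (hfd2 z).clm_apply (differentiableAt_const u)
  have happ' : ∀ x u v, fderiv ℝ (fun z => fderiv ℝ f z u) x v = fderiv ℝ (fderiv ℝ f) x v u := by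
    intro x u v
    have h := ((hfd2 x).hasFDerivAt.clm_apply (hasFDerivAt_const u x)).fderiv
    rw [h]
    simp
  have hsym : ∀ x u v, u ⬝ᵥ (H x *ᵥ v) = v ⬝ᵥ (H x *ᵥ u) := by
    intro x u v
    have hs : IsSymmSndFDerivAt ℝ f x :=
      hf.contDiffAt.isSymmSndFDerivAt (by simp)
    rw [← hH, ← hH, happ', happ']
    exact hs v u
  have hpsd : ∀ x v, 0 ≤ v ⬝ᵥ (H x *ᵥ v) := by
    intro x v
    have hder : deriv (fun s : ℝ => f (x + s • v)) = fun s => fderiv ℝ f (x + s • v) v :=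
      funext fun t => (line_hasDerivAt hfd x v t).deriv
    have hmono : Monotone (fun s : ℝ => fderiv ℝ f (x + s • v) v) := by
      rw [← hder]
      have := (line_convex hconv x v).monotoneOn_deriv
        (fun t _ => (line_hasDerivAt hfd x v t).differentiableAt)
      exact monotoneOn_univ.1 this
    have h2 := (line_hasDerivAt (happ v) x v 0).deriv
    have h3 := hmono.deriv_nonneg (x := 0)
    rw [h2] at h3
    simpa [hH] using h3
  have hgrad : ∀ x y, f x - f y ≤ g x ⬝ᵥ (x - y) := by
    intro x y
    have h1 := line_hasDerivAt hfd x (y - x) 0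
    have h2 := (line_convex hconv x (y - x)).le_slope_of_hasDerivAt
      (Set.mem_univ 0) (Set.mem_univ 1) one_pos h1
    simp only [slope_def_field, zero_smul, one_smul, add_zero, hg] at h2
    have e : g x ⬝ᵥ (x - y) = - (g x ⬝ᵥ (y - x)) := by
      rw [← dotProduct_neg, neg_sub]
    rw [e, dotProduct_sub]
    simp at h2
    linarith
  have hcs : ∀ x u v, u ⬝ᵥ (H x *ᵥ v) ≤ √(v ⬝ᵥ (H x *ᵥ v)) * √(u ⬝ᵥ (H x *ᵥ u)) := by
    intro x u v
    refine cs_aux _ _ _ (hpsd x u) (hpsd x v) fun t => ?_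
    have h := hpsd x (u + t • v)
    have hs := hsym x v u
    simp only [mulVec_add, mulVec_smul, dotProduct_add, add_dotProduct, smul_dotProduct,
      dotProduct_smul, smul_eq_mul] at h
    rw [hs] at h
    linarith
  intro x hx
  set s := √((Hdag x *ᵥ g x) ⬝ᵥ g x) with hs
  have hs0 : 0 ≤ s := Real.sqrt_nonneg _
  have key : ∀ r ∈ SR, f x - fstar ≤ r * s := by
    intro r hr
    rw [hSR] at hr
    obtain ⟨xs, hxs, hb⟩ := hr
    have hb := hb x hx
    obtain ⟨u, hu⟩ := hrange x
    rw [mulVecLin_apply] at hu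
    have hse : s = √(u ⬝ᵥ (H x *ᵥ u)) := by
      rw [hs, ← hu, hsym x, mulVec_mulVec, mulVec_mulVec, (hdag x).1]
    have h1 := hgrad x xs
    rw [hfstar xs hxs, ← hu, dotProduct_comm, hsym] at h1
    have h2 := hcs x u (x - xs)
    rw [← hse] at h2
    rw [dotProduct_comm] at hb
    exact h1.trans (h2.trans (mul_le_mul_of_nonneg_right hb hs0))
  rcases hs0.eq_or_lt with h0 | h0
  · obtain ⟨r, hr⟩ := hSRne
    have := key r hr
    rw [← h0] at this ⊢
    simpa using this
  · rw [← div_le_iff₀ h0, hR]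
    exact le_csInf hSRne fun r hr => (div_le_iff₀ h0).2 (key r hr)
end

section
/- Let H ∈ ℝ^{d×d} be symmetric positive semidefinite, let D be a probability distribution on ℝ^{d×s}, define the random matrix P̂(S) := H^{1/2} S (SᵀHS)† Sᵀ H^{1/2} and ρ := min_{v ∈ Range(H), v≠0} ⟨E_{S∼D}[P̂(S)] v, v⟩/‖v‖² (assuming the expectation exists and Range(H) ≠ {0}). Then 0 ≤ ρ ≤ 1. Moreover, if the exactness condition Range(H) = Range(E_{S∼D}[P̂(S)]) holds, then ρ = λ_min⁺(E_{S∼D}[P̂(S)]) > 0, where λ_min⁺ denotes the smallest nonzero eigenvalue. -/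
open Matrix MeasureTheory

/-- The smallest nonzero eigenvalue of a matrix. -/
noncomputable def lambdaMinPos {n : ℕ} (M : Matrix (Fin n) (Fin n) ℝ) : ℝ :=
  sInf {r : ℝ | r ≠ 0 ∧ Module.End.HasEigenvalue M.mulVecLin r}

theorem mp_symm {n : ℕ} (M G : Matrix (Fin n) (Fin n) ℝ) (hM : Mᵀ = M)
    (h : IsMoorePenrose M G) : Gᵀ = G := by
  obtain ⟨h1, h2, h3, h4⟩ := h
  have e3 : Gᵀ * M = M * G := by rw [← h3, transpose_mul, hM]
  have e4 : M * Gᵀ = G * M := by rw [← h4, transpose_mul, hM]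
  have h1' : M * Gᵀ * M = M := by
    have := congrArg transpose h1
    simpa [transpose_mul, hM, mul_assoc] using this
  have h2' : Gᵀ * M * Gᵀ = Gᵀ := by
    have := congrArg transpose h2
    simpa [transpose_mul, hM, mul_assoc] using this
  -- `M G = M Gᵀ`
  have a : M * G = M * Gᵀ := by
    have x : (M * Gᵀ) * (M * G) = M * G := by rw [← mul_assoc, h1']
    have y : (M * G) * (M * Gᵀ) = M * Gᵀ := by rw [← mul_assoc, h1]
    have z := congrArg transpose x
    rw [transpose_mul, h3, transpose_mul, transpose_transpose, hM, ← e4, y] at z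
    exact z.symm
  have b : G * M = Gᵀ * M := by rw [e3, a, e4]
  rw [← h2', mul_assoc, ← a, ← mul_assoc, ← b, h2]

theorem proj_bound {n : ℕ} (Q : Matrix (Fin n) (Fin n) ℝ) (hs : Qᵀ = Q) (hq : Q * Q = Q)
    (v : Fin n → ℝ) : 0 ≤ (Q *ᵥ v) ⬝ᵥ v ∧ (Q *ᵥ v) ⬝ᵥ v ≤ v ⬝ᵥ v := by
  have key : (Q *ᵥ v) ⬝ᵥ (Q *ᵥ v) = (Q *ᵥ v) ⬝ᵥ v := by
    rw [dotProduct_mulVec, ← mulVec_transpose, hs, mulVec_mulVec, hq]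
  have nn : ∀ w : Fin n → ℝ, 0 ≤ w ⬝ᵥ w := fun w =>
    Finset.sum_nonneg fun i _ => mul_self_nonneg _
  refine ⟨key ▸ nn _, ?_⟩
  have := nn (v - Q *ᵥ v)
  rw [sub_dotProduct, dotProduct_sub, dotProduct_sub, key, dotProduct_comm v (Q *ᵥ v)] at this
  linarith

theorem P_props {d s : ℕ} (H Hsqrt : Matrix (Fin d) (Fin d) ℝ)
    (h1 : Hsqrtᵀ = Hsqrt) (h2 : Hsqrt * Hsqrt = H) (S : Matrix (Fin d) (Fin s) ℝ)
    (G : Matrix (Fin s) (Fin s) ℝ) (hG : IsMoorePenrose (Sᵀ * H * S) G) :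
    (Hsqrt * S * G * Sᵀ * Hsqrt)ᵀ = Hsqrt * S * G * Sᵀ * Hsqrt ∧
    (Hsqrt * S * G * Sᵀ * Hsqrt) * (Hsqrt * S * G * Sᵀ * Hsqrt) =
      Hsqrt * S * G * Sᵀ * Hsqrt := by
  have hHt : Hᵀ = H := by rw [← h2, transpose_mul, h1]
  have hGt : Gᵀ = G := mp_symm _ _ (by simp [transpose_mul, hHt, Matrix.mul_assoc]) hG
  refine ⟨by simp [transpose_mul, h1, hGt, Matrix.mul_assoc], ?_⟩
  have e : (Hsqrt * S * G * Sᵀ * Hsqrt) * (Hsqrt * S * G * Sᵀ * Hsqrt) =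
      Hsqrt * S * (G * (Sᵀ * (Hsqrt * Hsqrt) * S) * G) * Sᵀ * Hsqrt := by
    simp only [Matrix.mul_assoc]
  rw [e, h2, hG.2.1]

theorem self_dot_pos {n : ℕ} (v : Fin n → ℝ) (hv : v ≠ 0) : 0 < v ⬝ᵥ v := by
  refine lt_of_le_of_ne (Finset.sum_nonneg fun i _ => mul_self_nonneg _) fun h => hv ?_
  exact dotProduct_self_eq_zero.1 h.symm

theorem spectral_part {n : ℕ} (A : Matrix (Fin n) (Fin n) ℝ) (hA : A.PosSemidef)
    (hne : A ≠ 0) : ∃ μ : ℝ, 0 < μ ∧ Module.End.HasEigenvalue A.mulVecLin μ ∧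
      ∀ v ∈ LinearMap.range A.mulVecLin, μ * (v ⬝ᵥ v) ≤ (A *ᵥ v) ⬝ᵥ v := by
  classical
  have hh := hA.isHermitian
  set U : Matrix (Fin n) (Fin n) ℝ := (hh.eigenvectorUnitary : Matrix (Fin n) (Fin n) ℝ) with hU
  set l := hh.eigenvalues with hl
  have hl0 : ∀ i, 0 ≤ l i := hA.eigenvalues_nonneg
  have hUU : Uᵀ * U = 1 := by
    have := Unitary.coe_star_mul_self hh.eigenvectorUnitary
    simpa [star_eq_conjTranspose] using this
  have hUU' : U * Uᵀ = 1 := mul_eq_one_comm.1 hUU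
  have hsp : A = U * diagonal l * Uᵀ := by
    have := hh.spectral_theorem
    simpa [Unitary.conjStarAlgAut_apply, star_eq_conjTranspose, Function.comp_def] using this
  have hex : ∃ i, l i ≠ 0 := by
    by_contra! hc
    apply hne
    have : l = 0 := funext hc
    rw [hsp, this]; simp
  obtain ⟨i0, hi0⟩ := hex
  obtain ⟨j, hj, hmin⟩ := (Finset.univ.filter fun i => l i ≠ 0).exists_min_image l
    ⟨i0, by simp [hi0]⟩
  have hj' : l j ≠ 0 := by simpa using hj
  refine ⟨l j, lt_of_le_of_ne (hl0 j) hj'.symm, ?_, ?_⟩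
  · have h1 : U * diagonal l = A * U := by
      rw [hsp, Matrix.mul_assoc _ Uᵀ, hUU, Matrix.mul_one]
    refine Module.End.hasEigenvalue_of_hasEigenvector (x := U *ᵥ Pi.single j 1)
      (Module.End.hasEigenvector_iff.2 ⟨Module.End.mem_eigenspace_iff.2 ?_, fun h => ?_⟩)
    · rw [mulVecLin_apply, mulVec_mulVec, ← h1, ← mulVec_mulVec, ← mulVec_smul]
      congr 1
      ext k
      by_cases hk : k = j
      · subst hk; simp [mulVec_diagonal]
      · simp [mulVec_diagonal, hk]
    · have := congrArg (fun x => Uᵀ *ᵥ x) h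
      simp only [mulVec_mulVec, hUU, one_mulVec, mulVec_zero] at this
      simpa using congrFun this j
  · rintro v ⟨w, rfl⟩
    rw [mulVecLin_apply]
    set e := Uᵀ *ᵥ w with he
    set c := diagonal l *ᵥ e with hc
    have hv : A *ᵥ w = U *ᵥ c := by rw [hc, he, mulVec_mulVec, mulVec_mulVec, ← hsp]
    have iso : ∀ x y, (U *ᵥ x) ⬝ᵥ (U *ᵥ y) = x ⬝ᵥ y := fun x y => by
      rw [dotProduct_mulVec, ← mulVec_transpose, mulVec_mulVec, hUU, one_mulVec]
    have h2 : A *ᵥ (U *ᵥ c) = U *ᵥ (diagonal l *ᵥ c) := by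
      conv_lhs => rw [hsp]
      rw [mulVec_mulVec c, Matrix.mul_assoc _ Uᵀ, hUU, Matrix.mul_one, mulVec_mulVec c]
    rw [hv, h2, iso, iso]
    simp only [dotProduct, Finset.mul_sum, mulVec_diagonal]
    refine Finset.sum_le_sum fun i _ => ?_
    by_cases h0 : l i = 0
    · have : c i = 0 := by rw [hc, mulVec_diagonal, h0, zero_mul]
      simp [this]
    · have := hmin i (by simp [h0])
      nlinarith [mul_le_mul_of_nonneg_right this (mul_self_nonneg (c i))]

/-- Let `H` be symmetric psd, `D` a probability distribution
over sketches `S` (modelled on the Pi type `Fin d → Fin s → ℝ`), let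
`P̂(S) = H^{1/2}S(SᵀHS)†SᵀH^{1/2}` and
`ρ = min_{0 ≠ v ∈ Range H} ⟨E[P̂(S)]v, v⟩/‖v‖²` (with `Range H ≠ {0}` and the
expectation `EP = E[P̂(S)]` assumed to exist).  Then `0 ≤ ρ ≤ 1`; moreover if the
exactness condition `Range(H) = Range(E[P̂(S)])` holds, then
`ρ = λ_min⁺(E[P̂(S)]) > 0`. -/
theorem stmt16 {d s : ℕ} (H : Matrix (Fin d) (Fin d) ℝ) (hH : H.PosSemidef)
    (Hsqrt : Matrix (Fin d) (Fin d) ℝ)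
    (hsqrt : Hsqrt.PosSemidef ∧ Hsqrt * Hsqrt = H)
    (D : Measure (Fin d → Fin s → ℝ)) [IsProbabilityMeasure D]
    (pinv : Matrix (Fin s) (Fin s) ℝ → Matrix (Fin s) (Fin s) ℝ)
    (hpinv : ∀ M, IsMoorePenrose M (pinv M))
    (EP : Matrix (Fin d) (Fin d) ℝ)
    (hEPint : ∀ i j, Integrable (fun S : Fin d → Fin s → ℝ =>
      (Hsqrt * Matrix.of S * pinv ((Matrix.of S)ᵀ * H * Matrix.of S) *
        (Matrix.of S)ᵀ * Hsqrt) i j) D)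
    (hEP : ∀ i j, EP i j = ∫ S, (Hsqrt * Matrix.of S *
      pinv ((Matrix.of S)ᵀ * H * Matrix.of S) * (Matrix.of S)ᵀ * Hsqrt) i j ∂D)
    (hHne : LinearMap.range H.mulVecLin ≠ ⊥)
    (ρ : ℝ) (hρ : ρ = sInf {r : ℝ | ∃ v ∈ LinearMap.range H.mulVecLin,
      v ≠ 0 ∧ r = (EP *ᵥ v) ⬝ᵥ v / (v ⬝ᵥ v)}) :
    (0 ≤ ρ ∧ ρ ≤ 1) ∧
    (LinearMap.range H.mulVecLin = LinearMap.range EP.mulVecLin →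
      ρ = lambdaMinPos EP ∧ 0 < ρ) := by
  have hst : Hsqrtᵀ = Hsqrt := by simpa using hsqrt.1.isHermitian.eq
  set P : (Fin d → Fin s → ℝ) → Matrix (Fin d) (Fin d) ℝ := fun S =>
    Hsqrt * Matrix.of S * pinv ((Matrix.of S)ᵀ * H * Matrix.of S) *
        (Matrix.of S)ᵀ * Hsqrt with hP
  have hPp : ∀ S, (P S)ᵀ = P S ∧ P S * P S = P S := fun S =>
    P_props H Hsqrt hst hsqrt.2 (Matrix.of S) _ (hpinv _)
  have hint : ∀ i j, Integrable (fun S => P S i j) D := hEPint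
  have hEP' : ∀ i j, EP i j = ∫ S, P S i j ∂D := hEP
  have hsym : EPᵀ = EP := by
    ext i j
    rw [transpose_apply, hEP', hEP']
    congr 1
    ext S
    exact congrFun (congrFun (hPp S).1 i) j
  have hexp : ∀ (S) (v : Fin d → ℝ), (P S *ᵥ v) ⬝ᵥ v = ∑ i, ∑ j, P S i j * v j * v i := by
    intro S v
    simp only [dotProduct, mulVec, Finset.sum_mul]
  have hi1 : ∀ (v : Fin d → ℝ) i j, Integrable (fun S => P S i j * v j * v i) D :=
    fun v i j => ((hint i j).mul_const _).mul_const _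
  have hintq : ∀ v : Fin d → ℝ, Integrable (fun S => (P S *ᵥ v) ⬝ᵥ v) D := by
    intro v
    simp only [hexp]
    exact integrable_finsetSum _ fun i _ => integrable_finsetSum _ fun j _ => hi1 v i j
  have hq : ∀ v : Fin d → ℝ, (EP *ᵥ v) ⬝ᵥ v = ∫ S, (P S *ᵥ v) ⬝ᵥ v ∂D := by
    intro v
    simp only [hexp]
    rw [integral_finsetSum _ fun i _ => integrable_finsetSum _ fun j _ => hi1 v i j]
    simp only [dotProduct, mulVec, Finset.sum_mul]
    refine Finset.sum_congr rfl fun i _ => ?_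
    rw [integral_finsetSum _ fun j _ => hi1 v i j]
    refine Finset.sum_congr rfl fun j _ => ?_
    rw [integral_mul_const, integral_mul_const, hEP']
  have hlo : ∀ v : Fin d → ℝ, 0 ≤ (EP *ᵥ v) ⬝ᵥ v := fun v => by
    rw [hq]
    exact integral_nonneg fun S => (proj_bound _ (hPp S).1 (hPp S).2 v).1
  have hhi : ∀ v : Fin d → ℝ, (EP *ᵥ v) ⬝ᵥ v ≤ v ⬝ᵥ v := fun v => by
    rw [hq]
    have := integral_mono (hintq v) (integrable_const (μ := D) (v ⬝ᵥ v))
      fun S => (proj_bound _ (hPp S).1 (hPp S).2 v).2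
    simpa using this
  set R := {r : ℝ | ∃ v ∈ LinearMap.range H.mulVecLin,
      v ≠ 0 ∧ r = (EP *ᵥ v) ⬝ᵥ v / (v ⬝ᵥ v)} with hR
  have hR0 : ∀ r ∈ R, 0 ≤ r := by
    rintro r ⟨v, -, hv, rfl⟩
    exact div_nonneg (hlo v) (self_dot_pos v hv).le
  constructor
  · obtain ⟨v, hvm, hv⟩ := (Submodule.ne_bot_iff _).1 hHne
    refine ⟨hρ ▸ Real.sInf_nonneg hR0, hρ ▸ ?_⟩
    refine (csInf_le ⟨0, hR0⟩ ⟨v, hvm, hv, rfl⟩).trans ?_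
    exact div_le_one_of_le₀ (hhi v) (self_dot_pos v hv).le
  · intro hrange
    have hpsd : EP.PosSemidef := by
      refine PosSemidef.of_dotProduct_mulVec_nonneg (by simpa [IsHermitian] using hsym) fun x => ?_
      rw [dotProduct_comm]
      simpa using hlo x
    have hne : EP ≠ 0 := by
      rintro h0
      apply hHne
      rw [hrange, h0]
      simp
    obtain ⟨μ, hμ, hev, hle⟩ := spectral_part EP hpsd hne
    have hsub : ∀ r, r ≠ 0 → Module.End.HasEigenvalue EP.mulVecLin r → r ∈ R := by
      intro r hr he
      obtain ⟨u, hu⟩ := he.exists_hasEigenvector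
      have h1 : EP *ᵥ u = r • u := hu.apply_eq_smul
      refine ⟨u, ?_, hu.2, ?_⟩
      · rw [hrange]
        refine ⟨r⁻¹ • u, ?_⟩
        rw [mulVecLin_apply, mulVec_smul, h1, smul_smul, inv_mul_cancel₀ hr, one_smul]
      · rw [h1, smul_dotProduct, smul_eq_mul, mul_div_assoc,
          div_self (self_dot_pos u hu.2).ne', mul_one]
    have hlb : ∀ r ∈ R, μ ≤ r := by
      rintro r ⟨v, hvm, hv, rfl⟩
      rw [le_div_iff₀ (self_dot_pos v hv)]
      exact hle v (hrange ▸ hvm)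
    have hl1 : IsLeast R μ := ⟨hsub μ hμ.ne' hev, hlb⟩
    have hl2 : IsLeast {r : ℝ | r ≠ 0 ∧ Module.End.HasEigenvalue EP.mulVecLin r} μ :=
      ⟨⟨hμ.ne', hev⟩, fun r hr => hlb r (hsub r hr.1 hr.2)⟩
    have e1 : ρ = μ := hρ.trans hl1.csInf_eq
    exact ⟨e1.trans hl2.csInf_eq.symm, e1 ▸ hμ⟩
end

section
/- Let H ∈ ℝ^{d×d} be symmetric positive semidefinite and let D be a probability distribution on ℝ^{d×s} such that: (i) Null(SᵀHS) = Null(S) holds D-almost surely (nullspace preservation), and (ii) Range(H) ⊆ Range(E_{S∼D}[SSᵀ]) (assuming the relevant expectations exist). Then the exactness condition Range(H) = Range(E_{S∼D}[H^{1/2} S (SᵀHS)† Sᵀ H^{1/2}]) holds; consequently 0 < ρ ≤ 1, where ρ := min_{v ∈ Range(H), v≠0} ⟨E_{S∼D}[H^{1/2} S (SᵀHS)† Sᵀ H^{1/2}] v, v⟩/‖v‖² (assuming Range(H) ≠ {0}). -/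
open Matrix MeasureTheory

lemma aux_AtA {m n k : ℕ} (A : Matrix (Fin m) (Fin n) ℝ) (X : Matrix (Fin n) (Fin k) ℝ)
    (h : Aᵀ * A * X = 0) : A * X = 0 := by
  have := (Matrix.conjTranspose_mul_self_mul_eq_zero A X).1 (by
    simpa [Matrix.conjTranspose_eq_transpose_of_trivial] using h)
  exact this

lemma aux_proj {m n : ℕ} (A : Matrix (Fin m) (Fin n) ℝ) (N : Matrix (Fin n) (Fin n) ℝ)
    (h : (Aᵀ * A) * N * (Aᵀ * A) = Aᵀ * A) :
    (A * N * Aᵀ)ᵀ = A * N * Aᵀ ∧ (A * N * Aᵀ) * (A * N * Aᵀ) = A * N * Aᵀ ∧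
      Aᵀ * (A * N * Aᵀ) = Aᵀ := by
  have h1 : A * N * Aᵀ * A = A := by
    have := aux_AtA A (N * (Aᵀ * A) - 1) (by
      rw [Matrix.mul_sub, ← Matrix.mul_assoc, h, Matrix.mul_one, sub_self])
    rw [Matrix.mul_sub, Matrix.mul_one, sub_eq_zero] at this
    simpa [Matrix.mul_assoc] using this
  have h2 : Aᵀ * (A * N * Aᵀ)ᵀ = Aᵀ := by
    rw [← Matrix.transpose_mul, h1]
  have h3 : (A * N * Aᵀ) * (A * N * Aᵀ)ᵀ = A * N * Aᵀ := by
    rw [Matrix.mul_assoc (A * N), h2]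
  have h4 : (A * N * Aᵀ)ᵀ = A * N * Aᵀ := by
    rw [← h3, Matrix.transpose_mul, Matrix.transpose_transpose]
  refine ⟨h4, ?_, ?_⟩
  · rw [h4] at h3; exact h3
  · rw [h4] at h2; exact h2

lemma aux_int {Ω : Type*} [MeasurableSpace Ω] {D : Measure Ω} {m n : ℕ}
    (F : Ω → Matrix (Fin m) (Fin n) ℝ) (E : Matrix (Fin m) (Fin n) ℝ)
    (hi : ∀ i j, Integrable (fun S => F S i j) D) (hE : ∀ i j, E i j = ∫ S, F S i j ∂D)
    (v : Fin n → ℝ) (w : Fin m → ℝ) :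
    Integrable (fun S => (F S *ᵥ v) ⬝ᵥ w) D ∧ (E *ᵥ v) ⬝ᵥ w = ∫ S, (F S *ᵥ v) ⬝ᵥ w ∂D := by
  simp only [Matrix.mulVec, dotProduct]
  have h1 : ∀ i j, Integrable (fun S => F S i j * v j) D := fun i j => (hi i j).mul_const _
  have h2 : ∀ i, Integrable (fun S => ∑ j, F S i j * v j) D :=
    fun i => integrable_finsetSum _ fun j _ => h1 i j
  refine ⟨integrable_finsetSum _ fun i _ => (h2 i).mul_const _, ?_⟩
  rw [integral_finsetSum _ fun i _ => (h2 i).mul_const _]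
  refine Finset.sum_congr rfl fun i _ => ?_
  rw [integral_mul_const, integral_finsetSum _ fun j _ => h1 i j]
  congr 1
  refine Finset.sum_congr rfl fun j _ => ?_
  rw [integral_mul_const, hE]

lemma aux_sym {n : ℕ} {A : Matrix (Fin n) (Fin n) ℝ} (hA : Aᵀ = A) (v w : Fin n → ℝ) :
    (A *ᵥ v) ⬝ᵥ w = v ⬝ᵥ (A *ᵥ w) := by
  rw [Matrix.dotProduct_mulVec, ← Matrix.mulVec_transpose, hA]

lemma aux_sq {n : ℕ} {A : Matrix (Fin n) (Fin n) ℝ} (hA : Aᵀ = A) (v : Fin n → ℝ)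
    (h : A *ᵥ (A *ᵥ v) = 0) : A *ᵥ v = 0 := by
  apply dotProduct_self_eq_zero.1
  rw [aux_sym hA, h, dotProduct_zero]

lemma aux_range_s17 {n : ℕ} {A B : Matrix (Fin n) (Fin n) ℝ} (hA : Aᵀ = A) (hB : Bᵀ = B)
    (h : ∀ v, A *ᵥ v = 0 → B *ᵥ v = 0) :
    LinearMap.range B.mulVecLin ≤ LinearMap.range A.mulVecLin := by
  obtain ⟨C, hC⟩ : ∃ C : Matrix (Fin n) (Fin n) ℝ, C * A = B := by
    obtain ⟨g, hg⟩ := LinearMap.exists_extend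
      (((LinearMap.ker A.mulVecLin).liftQ B.mulVecLin h).comp
        A.mulVecLin.quotKerEquivRange.symm.toLinearMap)
    refine ⟨LinearMap.toMatrix' g, ?_⟩
    apply Matrix.mulVec_injective
    funext v
    have h1 := LinearMap.congr_fun hg ⟨A.mulVecLin v, v, rfl⟩
    have h2 : A.mulVecLin.quotKerEquivRange.symm ⟨A.mulVecLin v, v, rfl⟩
        = (LinearMap.ker A.mulVecLin).mkQ v := by
      rw [LinearEquiv.symm_apply_eq]; rfl
    rw [LinearMap.comp_apply, LinearMap.comp_apply, LinearEquiv.coe_coe, h2] at h1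
    have h3 : g (A *ᵥ v) = B *ᵥ v := h1
    rw [← Matrix.mulVec_mulVec, LinearMap.toMatrix'_mulVec, h3]
  rintro _ ⟨v, rfl⟩
  refine ⟨Cᵀ *ᵥ v, ?_⟩
  simp only [Matrix.mulVecLin_apply, Matrix.mulVec_mulVec]
  rw [← hB, ← hC, Matrix.transpose_mul, hA]

/-- Sufficient conditions for exactness.  Let `H` be symmetric
psd and `D` a probability distribution over sketches `S` (modelled on the Pi
type `Fin d → Fin s → ℝ`) such that (i) `Null(SᵀHS) = Null(S)` holds `D`-a.s.
and (ii) `Range(H) ⊆ Range(E[SSᵀ])`.  Then the exactness condition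
`Range(H) = Range(E[H^{1/2}S(SᵀHS)†SᵀH^{1/2}])` holds; consequently `0 < ρ ≤ 1`
where `ρ = min_{0 ≠ v ∈ Range H} ⟨E[H^{1/2}S(SᵀHS)†SᵀH^{1/2}]v, v⟩/‖v‖²`
(assuming `Range H ≠ {0}`). -/
theorem stmt17 {d s : ℕ} (H : Matrix (Fin d) (Fin d) ℝ) (hH : H.PosSemidef)
    (Hsqrt : Matrix (Fin d) (Fin d) ℝ)
    (hsqrt : Hsqrt.PosSemidef ∧ Hsqrt * Hsqrt = H)
    (D : Measure (Fin d → Fin s → ℝ)) [IsProbabilityMeasure D]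
    (pinv : Matrix (Fin s) (Fin s) ℝ → Matrix (Fin s) (Fin s) ℝ)
    (hpinv : ∀ M, IsMoorePenrose M (pinv M))
    (hnull : ∀ᵐ S ∂D,
      LinearMap.ker ((Matrix.of S)ᵀ * H * Matrix.of S).mulVecLin =
        LinearMap.ker (Matrix.of S).mulVecLin)
    (ESS : Matrix (Fin d) (Fin d) ℝ)
    (hESSint : ∀ i j, Integrable (fun S : Fin d → Fin s → ℝ =>
      (Matrix.of S * (Matrix.of S)ᵀ) i j) D)
    (hESS : ∀ i j, ESS i j = ∫ S, (Matrix.of S * (Matrix.of S)ᵀ) i j ∂D)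
    (hrange : LinearMap.range H.mulVecLin ≤ LinearMap.range ESS.mulVecLin)
    (EP : Matrix (Fin d) (Fin d) ℝ)
    (hEPint : ∀ i j, Integrable (fun S : Fin d → Fin s → ℝ =>
      (Hsqrt * Matrix.of S * pinv ((Matrix.of S)ᵀ * H * Matrix.of S) *
        (Matrix.of S)ᵀ * Hsqrt) i j) D)
    (hEP : ∀ i j, EP i j = ∫ S, (Hsqrt * Matrix.of S *
      pinv ((Matrix.of S)ᵀ * H * Matrix.of S) * (Matrix.of S)ᵀ * Hsqrt) i j ∂D)
    (hHne : LinearMap.range H.mulVecLin ≠ ⊥)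
    (ρ : ℝ) (hρ : ρ = sInf {r : ℝ | ∃ v ∈ LinearMap.range H.mulVecLin,
      v ≠ 0 ∧ r = (EP *ᵥ v) ⬝ᵥ v / (v ⬝ᵥ v)}) :
    LinearMap.range H.mulVecLin = LinearMap.range EP.mulVecLin ∧
    0 < ρ ∧ ρ ≤ 1 := by
  classical
  obtain ⟨hBp, hBB⟩ := hsqrt
  have hB : Hsqrtᵀ = Hsqrt := by
    simpa [Matrix.conjTranspose_eq_transpose_of_trivial] using hBp.1.eq
  have hHs : Hᵀ = H := by
    simpa [Matrix.conjTranspose_eq_transpose_of_trivial] using hH.1.eq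
  set P : (Fin d → Fin s → ℝ) → Matrix (Fin d) (Fin d) ℝ := fun S =>
    Hsqrt * Matrix.of S * pinv ((Matrix.of S)ᵀ * H * Matrix.of S) * (Matrix.of S)ᵀ * Hsqrt with hPdef
  have hP : ∀ S, (P S)ᵀ = P S ∧ P S * P S = P S ∧
      (Matrix.of S)ᵀ * Hsqrt * P S = (Matrix.of S)ᵀ * Hsqrt := by
    intro S
    have hM : (Hsqrt * Matrix.of S)ᵀ * (Hsqrt * Matrix.of S)
        = (Matrix.of S)ᵀ * H * Matrix.of S := by
      rw [Matrix.transpose_mul, hB, ← hBB]; simp only [Matrix.mul_assoc]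
    have := aux_proj (Hsqrt * Matrix.of S) (pinv ((Matrix.of S)ᵀ * H * Matrix.of S))
      (by rw [hM]; exact (hpinv _).1)
    have hPS : Hsqrt * Matrix.of S * pinv ((Matrix.of S)ᵀ * H * Matrix.of S) *
        (Hsqrt * Matrix.of S)ᵀ = P S := by
      rw [Matrix.transpose_mul, hB]; simp only [hPdef, Matrix.mul_assoc]
    rw [hPS, Matrix.transpose_mul Hsqrt (Matrix.of S), hB] at this
    exact this
  have hEPi := aux_int P EP hEPint hEP
  have hq : ∀ S v, (P S *ᵥ v) ⬝ᵥ v = (P S *ᵥ v) ⬝ᵥ (P S *ᵥ v) := by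
    intro S v
    rw [← aux_sym (hP S).1, Matrix.mulVec_mulVec, (hP S).2.1]
  have hq0 : ∀ S v, 0 ≤ (P S *ᵥ v) ⬝ᵥ v := by
    intro S v; rw [hq]; exact Finset.sum_nonneg fun i _ => mul_self_nonneg _
  have hq1 : ∀ S v, (P S *ᵥ v) ⬝ᵥ v ≤ v ⬝ᵥ v := by
    intro S v
    have h0 : 0 ≤ (v - P S *ᵥ v) ⬝ᵥ (v - P S *ᵥ v) :=
      Finset.sum_nonneg fun i _ => mul_self_nonneg _
    have := hq S v
    rw [sub_dotProduct, dotProduct_sub, dotProduct_sub, dotProduct_comm v (P S *ᵥ v)] at h0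
    linarith
  have hE0 : ∀ v, 0 ≤ (EP *ᵥ v) ⬝ᵥ v := fun v => by
    rw [(hEPi v v).2]; exact integral_nonneg fun S => hq0 S v
  have hE1 : ∀ v, (EP *ᵥ v) ⬝ᵥ v ≤ v ⬝ᵥ v := fun v => by
    rw [(hEPi v v).2]
    calc _ ≤ ∫ S, v ⬝ᵥ v ∂D := integral_mono (hEPi v v).1 (integrable_const _) fun S => hq1 S v
      _ = _ := by simp
  have hEs : EPᵀ = EP := by
    ext i j
    rw [Matrix.transpose_apply, hEP, hEP]
    congr 1; ext S
    change P S j i = P S i j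
    conv_rhs => rw [← (hP S).1, Matrix.transpose_apply]
  have hker1 : ∀ v, H *ᵥ v = 0 → EP *ᵥ v = 0 := by
    intro v hv
    have hBv : Hsqrt *ᵥ v = 0 := aux_sq hB v (by rw [Matrix.mulVec_mulVec, hBB, hv])
    apply dotProduct_self_eq_zero.1
    rw [(hEPi v _).2]
    have : ∀ S, P S *ᵥ v = 0 := fun S => by
      simp only [hPdef, ← Matrix.mulVec_mulVec, hBv, Matrix.mulVec_zero]
    simp [this]
  have hker2 : ∀ v, (EP *ᵥ v) ⬝ᵥ v = 0 → H *ᵥ v = 0 := by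
    intro v hv
    rw [(hEPi v v).2, integral_eq_zero_iff_of_nonneg (fun S => hq0 S v) (hEPi v v).1] at hv
    have hSB : ∀ᵐ S ∂D, (Matrix.of S)ᵀ *ᵥ (Hsqrt *ᵥ v) = 0 := by
      filter_upwards [hv] with S hS
      have : P S *ᵥ v = 0 := by
        apply dotProduct_self_eq_zero.1
        rw [← hq]; exact hS
      rw [Matrix.mulVec_mulVec, ← (hP S).2.2, ← Matrix.mulVec_mulVec, this, Matrix.mulVec_zero]
    have hESi := aux_int (fun S : Fin d → Fin s → ℝ => Matrix.of S * (Matrix.of S)ᵀ) ESS hESSint hESS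
    have hz : ∀ w, (ESS *ᵥ (Hsqrt *ᵥ v)) ⬝ᵥ w = 0 := by
      intro w
      rw [(hESi _ _).2]
      apply integral_eq_zero_of_ae
      filter_upwards [hSB] with S hS
      rw [← Matrix.mulVec_mulVec, hS]; simp
    have hESs : ESSᵀ = ESS := by
      ext i j
      rw [Matrix.transpose_apply, hESS, hESS]
      congr 1; ext S
      simp only [Matrix.mul_apply, Matrix.transpose_apply, mul_comm]
    have hHB : H *ᵥ (Hsqrt *ᵥ v) = 0 := by
      apply dotProduct_self_eq_zero.1
      obtain ⟨u, hu⟩ := hrange ⟨H *ᵥ (Hsqrt *ᵥ v), rfl⟩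
      simp only [Matrix.mulVecLin_apply] at hu
      rw [aux_sym hHs, ← hu, ← aux_sym hESs]
      exact hz u
    rw [← hBB, ← Matrix.mulVec_mulVec] at hHB ⊢
    exact aux_sq hB _ hHB
  have hker3 : ∀ v, EP *ᵥ v = 0 → H *ᵥ v = 0 := fun v hv => hker2 v (by rw [hv, zero_dotProduct])
  refine ⟨le_antisymm (aux_range_s17 hEs hHs hker3) (aux_range_s17 hHs hEs hker1), ?_⟩
  have hpos : ∀ v ∈ LinearMap.range H.mulVecLin, v ≠ 0 → 0 < (EP *ᵥ v) ⬝ᵥ v := by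
    rintro v ⟨u, hu⟩ hne
    refine lt_of_le_of_ne (hE0 v) fun h => hne ?_
    have := hker2 v h.symm
    simp only [Matrix.mulVecLin_apply] at hu
    rw [← hu] at this ⊢
    exact aux_sq hHs u this
  have hvv : ∀ v : Fin d → ℝ, v ≠ 0 → 0 < v ⬝ᵥ v := fun v hv =>
    lt_of_le_of_ne (Finset.sum_nonneg fun i _ => mul_self_nonneg _)
      fun h => hv (dotProduct_self_eq_zero.1 h.symm)
  obtain ⟨v0, hv0, hv0n⟩ := Submodule.exists_mem_ne_zero_of_ne_bot hHne
  set K : Set (Fin d → ℝ) := {v | v ∈ LinearMap.range H.mulVecLin ∧ v ⬝ᵥ v = 1} with hK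
  have hnorm : ∀ v ∈ LinearMap.range H.mulVecLin, v ≠ 0 →
      ((Real.sqrt (v ⬝ᵥ v))⁻¹ • v) ∈ K := by
    intro v hv hn
    refine ⟨Submodule.smul_mem _ _ hv, ?_⟩
    have h := hvv v hn
    rw [smul_dotProduct, dotProduct_smul, smul_eq_mul, smul_eq_mul, ← mul_assoc, ← mul_inv,
      Real.mul_self_sqrt h.le, inv_mul_cancel₀ h.ne']
  have hKc : IsCompact K := by
    apply Metric.isCompact_of_isClosed_isBounded
    · have h1 : IsClosed ((LinearMap.range H.mulVecLin : Submodule ℝ (Fin d → ℝ)) : Set (Fin d → ℝ)) :=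
        Submodule.closed_of_finiteDimensional _
      have h2 : IsClosed {v : Fin d → ℝ | v ⬝ᵥ v = 1} :=
        isClosed_eq (by unfold dotProduct; fun_prop) continuous_const
      exact h1.inter h2
    · refine (Metric.isBounded_closedBall (x := (0 : Fin d → ℝ)) (r := 1)).subset ?_
      rintro v ⟨_, hv⟩
      rw [mem_closedBall_zero_iff, pi_norm_le_iff_of_nonneg zero_le_one]
      intro i
      have : v i * v i ≤ v ⬝ᵥ v :=
        Finset.single_le_sum (f := fun i => v i * v i) (fun i _ => mul_self_nonneg _) (Finset.mem_univ i)
      rw [Real.norm_eq_abs, abs_le]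
      constructor <;> nlinarith
  obtain ⟨w, hwK, hw⟩ := hKc.exists_isMinOn ⟨_, hnorm v0 hv0 hv0n⟩
    (f := fun v => (EP *ᵥ v) ⬝ᵥ v)
    (by unfold Matrix.mulVec dotProduct; fun_prop)
  have hwn : w ≠ 0 := by rintro rfl; simpa using hwK.2
  have hwp := hpos w hwK.1 hwn
  have hlb : ∀ r ∈ {r : ℝ | ∃ v ∈ LinearMap.range H.mulVecLin,
      v ≠ 0 ∧ r = (EP *ᵥ v) ⬝ᵥ v / (v ⬝ᵥ v)}, (EP *ᵥ w) ⬝ᵥ w ≤ r := by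
    rintro r ⟨v, hv, hn, rfl⟩
    have h := hw (hnorm v hv hn)
    have h' := hvv v hn
    simp only [Set.mem_ofPred_eq] at h
    rw [Matrix.mulVec_smul, smul_dotProduct, dotProduct_smul, smul_eq_mul, smul_eq_mul,
      ← mul_assoc, ← mul_inv, Real.mul_self_sqrt h'.le] at h
    rw [div_eq_inv_mul]; exact h
  rw [hρ]
  constructor
  · exact lt_of_lt_of_le hwp (le_csInf ⟨_, v0, hv0, hv0n, rfl⟩ hlb)
  · refine (csInf_le ⟨_, hlb⟩ ⟨v0, hv0, hv0n, rfl⟩).trans ?_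
    exact (div_le_one (hvv v0 hv0n)).2 (hE1 v0)
end

section
/- Let H ∈ ℝ^{d×d} be symmetric positive semidefinite with H(x) ⪯ U for a symmetric positive definite matrix U ∈ ℝ^{d×d}, where H = H(x) is the Hessian of a function at some point x; let D = [d_1, …, d_d] ∈ ℝ^{d×d} be an invertible matrix with d_iᵀ H d_i ≠ 0 for all i, and set p_i := d_iᵀ U d_i / trace(Dᵀ U D), so that (p_1, …, p_d) is a probability vector. Then for the single-column sketch distribution that picks S = d_i with probability p_i, the expected matrix satisfies E[S(SᵀHS)†Sᵀ] = Σ_{i=1}^d p_i · d_i d_iᵀ/(d_iᵀ H d_i) ⪰ D Dᵀ / trace(Dᵀ U D) in the Loewner order; consequently λ_min⁺(H^{1/2} E[S(SᵀHS)†Sᵀ] H^{1/2}) ≥ λ_min⁺(H^{1/2} D Dᵀ H^{1/2}) / trace(Dᵀ U D). -/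
open Matrix

theorem aux_rayleigh {d : ℕ} (A : Matrix (Fin d) (Fin d) ℝ) (hA : A.PosSemidef)
    (v : Fin d → ℝ) (hv : ∀ w, A *ᵥ w = 0 → w ⬝ᵥ v = 0) :
    lambdaMinPos A * (v ⬝ᵥ v) ≤ v ⬝ᵥ (A *ᵥ v) := by
  set b := hA.1.eigenvectorBasis with hb
  have key : ∀ x y : Fin d → ℝ, x ⬝ᵥ y = ∑ i, (⇑(b i) ⬝ᵥ x) * (⇑(b i) ⬝ᵥ y) := by
    intro x y
    have h := b.sum_inner_mul_inner (WithLp.toLp 2 x) (WithLp.toLp 2 y)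
    simp only [EuclideanSpace.inner_eq_star_dotProduct, star_trivial] at h
    rw [dotProduct_comm x y, ← h]
    refine Finset.sum_congr rfl fun i _ => ?_
    rw [dotProduct_comm y]
  have hbA : ∀ i, A *ᵥ ⇑(b i) = hA.1.eigenvalues i • ⇑(b i) := fun i =>
    hA.1.mulVec_eigenvectorBasis i
  have hAs : Aᵀ = A := by simpa [conjTranspose_eq_transpose_of_trivial] using hA.1.eq
  have hAv : ∀ i, ⇑(b i) ⬝ᵥ (A *ᵥ v) = hA.1.eigenvalues i * (⇑(b i) ⬝ᵥ v) := by
    intro i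
    rw [dotProduct_mulVec, ← mulVec_transpose, hAs, hbA, smul_dotProduct, smul_eq_mul]
  rw [key v v, key v (A *ᵥ v), Finset.mul_sum]
  refine Finset.sum_le_sum fun i _ => ?_
  rw [hAv]
  by_cases h0 : hA.1.eigenvalues i = 0
  · have := hv (⇑(b i)) (by rw [hbA, h0, zero_smul])
    rw [this]; simp
  · have hle : lambdaMinPos A ≤ hA.1.eigenvalues i := by
      refine csInf_le ⟨0, ?_⟩ ⟨h0, ?_⟩
      · rintro r ⟨_, hr⟩
        obtain ⟨x, hx⟩ := hr.exists_hasEigenvector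
        have h1 : A *ᵥ x = r • x := hx.apply_eq_smul
        have h2 := hA.dotProduct_mulVec_nonneg x
        rw [h1, star_trivial, dotProduct_smul, smul_eq_mul] at h2
        have h3 : 0 < x ⬝ᵥ x := by simpa using dotProduct_star_self_pos_iff.2 hx.2
        exact nonneg_of_mul_nonneg_left h2 h3
      · refine Module.End.hasEigenvalue_of_hasEigenvector (x := ⇑(b i))
          (Module.End.hasEigenvector_iff.2 ⟨Module.End.mem_eigenspace_iff.2 (hbA i), ?_⟩)
        intro hz
        apply b.orthonormal.ne_zero i
        ext j
        exact congrFun hz j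
    nlinarith [mul_le_mul_of_nonneg_right hle (mul_self_nonneg (⇑(b i) ⬝ᵥ v))]

theorem aux_eig {d : ℕ} (A : Matrix (Fin d) (Fin d) ℝ) (hA : A.PosSemidef) (r : ℝ)
    (h : Module.End.HasEigenvalue A.mulVecLin r) :
    ∃ x, A *ᵥ x = r • x ∧ 0 < x ⬝ᵥ x ∧ 0 ≤ r := by
  obtain ⟨x, hx⟩ := h.exists_hasEigenvector
  have h1 : A *ᵥ x = r • x := hx.apply_eq_smul
  have h2 := hA.dotProduct_mulVec_nonneg x
  rw [h1, star_trivial, dotProduct_smul, smul_eq_mul] at h2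
  have h3 : 0 < x ⬝ᵥ x := by simpa using dotProduct_star_self_pos_iff.2 hx.2
  exact ⟨x, h1, h3, nonneg_of_mul_nonneg_left h2 h3⟩

theorem aux_empty {d : ℕ} (A : Matrix (Fin d) (Fin d) ℝ) (hA : A.PosSemidef)
    (h : ∀ r : ℝ, r ≠ 0 → ¬ Module.End.HasEigenvalue A.mulVecLin r) : A = 0 := by
  rw [← hA.1.eigenvalues_eq_zero_iff]
  funext i
  by_contra h0
  refine h _ h0 (Module.End.hasEigenvalue_of_hasEigenvector (x := ⇑(hA.1.eigenvectorBasis i))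
          (Module.End.hasEigenvector_iff.2 ⟨Module.End.mem_eigenspace_iff.2
            (hA.1.mulVec_eigenvectorBasis i), ?_⟩))
  intro hz
  apply hA.1.eigenvectorBasis.orthonormal.ne_zero i
  ext j
  exact congrFun hz j

/-- Single column sketches.  Let `H` be symmetric psd with
`H ⪯ U` for a symmetric positive definite `U`, let `D = [d_1, …, d_d]` be
invertible with `d_iᵀHd_i ≠ 0` for all `i`, and set
`p_i = d_iᵀUd_i / trace(DᵀUD)`.  For the single-column sketch distribution
picking `S = d_i` with probability `p_i` (so that `S(SᵀHS)†Sᵀ = d_id_iᵀ/(d_iᵀHd_i)`),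
the expected matrix `E[S(SᵀHS)†Sᵀ] = Σ_i p_i·d_id_iᵀ/(d_iᵀHd_i)` dominates
`DDᵀ/trace(DᵀUD)` in the Loewner order; consequently
`λ_min⁺(H^{1/2}E[S(SᵀHS)†Sᵀ]H^{1/2}) ≥ λ_min⁺(H^{1/2}DDᵀH^{1/2})/trace(DᵀUD)`. -/
theorem stmt18 {d : ℕ} (H U : Matrix (Fin d) (Fin d) ℝ)
    (hH : H.PosSemidef) (hU : U.PosDef) (hHU : (U - H).PosSemidef)
    (Hsqrt : Matrix (Fin d) (Fin d) ℝ)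
    (hsqrt : Hsqrt.PosSemidef ∧ Hsqrt * Hsqrt = H)
    (Dm : Matrix (Fin d) (Fin d) ℝ) (hDm : IsUnit Dm.det)
    (col : Fin d → Fin d → ℝ) (hcol : ∀ i j, col i j = Dm j i)
    (hHcol : ∀ i, col i ⬝ᵥ (H *ᵥ col i) ≠ 0)
    (p : Fin d → ℝ)
    (hp : ∀ i, p i = (col i ⬝ᵥ (U *ᵥ col i)) / (Dmᵀ * U * Dm).trace
)
    (E : Matrix (Fin d) (Fin d) ℝ)
    (hE : E = ∑ i, p i • ((col i ⬝ᵥ (H *ᵥ col i))⁻¹ • vecMulVec (col i) (col i))) :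
    (E - ((Dmᵀ * U * Dm).trace)⁻¹ • (Dm * Dmᵀ)).PosSemidef ∧
    lambdaMinPos (Hsqrt * Dm * Dmᵀ * Hsqrt) / (Dmᵀ * U * Dm).trace ≤
      lambdaMinPos (Hsqrt * E * Hsqrt) := by
  obtain ⟨hs, hss⟩ := hsqrt
  have hst : Hsqrtᵀ = Hsqrt := by simpa [conjTranspose_eq_transpose_of_trivial] using hs.1.eq
  set t := (Dmᵀ * U * Dm).trace with ht
  have ht0 : 0 ≤ t := by
    have := (hU.posSemidef.conjTranspose_mul_mul_same Dm).trace_nonneg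
    simpa [conjTranspose_eq_transpose_of_trivial] using this
  have hc : 0 ≤ t⁻¹ := inv_nonneg.2 ht0
  have hDD : Dm * Dmᵀ = ∑ i, vecMulVec (col i) (col i) := by
    ext a b
    simp [Matrix.mul_apply, Matrix.sum_apply, vecMulVec_apply, hcol]
  have hvv : ∀ i, (vecMulVec (col i) (col i)).PosSemidef := fun i => by
    simpa using posSemidef_vecMulVec_self_star (col i)
  have h1 : (E - t⁻¹ • (Dm * Dmᵀ)).PosSemidef := by
    have : E - t⁻¹ • (Dm * Dmᵀ) = ∑ i, (t⁻¹ * ((col i ⬝ᵥ (U *ᵥ col i)) *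
        (col i ⬝ᵥ (H *ᵥ col i))⁻¹ - 1)) • vecMulVec (col i) (col i) := by
      rw [hE, hDD, Finset.smul_sum, ← Finset.sum_sub_distrib]
      refine Finset.sum_congr rfl fun i _ => ?_
      rw [smul_smul, ← sub_smul, hp]
      congr 1
      ring
    rw [this]
    refine posSemidef_sum _ fun i _ => (hvv i).smul (mul_nonneg hc ?_)
    have hpos : 0 < col i ⬝ᵥ (H *ᵥ col i) :=
      lt_of_le_of_ne (by simpa using hH.dotProduct_mulVec_nonneg (col i)) (hHcol i).symm
    have hle := hHU.dotProduct_mulVec_nonneg (col i)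
    rw [star_trivial, sub_mulVec, dotProduct_sub] at hle
    rw [← div_eq_mul_inv, sub_nonneg, le_div_iff₀ hpos]
    linarith
  refine ⟨h1, ?_⟩
  have hA : (Hsqrt * Dm * Dmᵀ * Hsqrt).PosSemidef := by
    have := posSemidef_conjTranspose_mul_self (Dmᵀ * Hsqrt)
    simpa [conjTranspose_eq_transpose_of_trivial, hst, Matrix.mul_assoc] using this
  have hDDp : (Dm * Dmᵀ).PosSemidef := by
    simpa [conjTranspose_eq_transpose_of_trivial] using posSemidef_self_mul_conjTranspose Dm
  have hEp : E.PosSemidef := by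
    simpa using h1.add (hDDp.smul hc)
  have hB : (Hsqrt * E * Hsqrt).PosSemidef := by
    have := hEp.conjTranspose_mul_mul_same Hsqrt
    simpa [conjTranspose_eq_transpose_of_trivial, hst] using this
  have hBA : ∀ v, t⁻¹ * (v ⬝ᵥ ((Hsqrt * Dm * Dmᵀ * Hsqrt) *ᵥ v)) ≤
      v ⬝ᵥ ((Hsqrt * E * Hsqrt) *ᵥ v) := by
    intro v
    have h2 := h1.conjTranspose_mul_mul_same Hsqrt
    have h3 := h2.dotProduct_mulVec_nonneg v
    have h4 : Hsqrtᴴ * (E - t⁻¹ • (Dm * Dmᵀ)) * Hsqrt =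
        Hsqrt * E * Hsqrt - t⁻¹ • (Hsqrt * Dm * Dmᵀ * Hsqrt) := by
      rw [hs.1.eq]
      simp [Matrix.mul_sub, Matrix.sub_mul, Matrix.mul_assoc]
    rw [h4, star_trivial, sub_mulVec, dotProduct_sub, smul_mulVec, dotProduct_smul,
      smul_eq_mul] at h3
    linarith
  rw [div_eq_mul_inv]
  by_cases hne : ∃ r : ℝ, r ≠ 0 ∧ Module.End.HasEigenvalue (Hsqrt * E * Hsqrt).mulVecLin r
  · refine le_csInf hne ?_
    rintro r ⟨hr0, hr⟩
    obtain ⟨x, hx, hxx, hr1⟩ := aux_eig _ hB r hr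
    have hray := aux_rayleigh _ hA x (by
      intro w hw
      have hw1 : (Dmᵀ * Hsqrt) *ᵥ w = 0 := by
        have h5 : (Dmᵀ * Hsqrt)ᴴ * (Dmᵀ * Hsqrt) = Hsqrt * Dm * Dmᵀ * Hsqrt := by
          simp [conjTranspose_eq_transpose_of_trivial, hst, Matrix.mul_assoc]
        rw [← h5] at hw
        exact (conjTranspose_mul_self_mulVec_eq_zero _ _).1 hw
      have hw2 : Hsqrt *ᵥ w = 0 := by
        rw [← mulVec_mulVec] at hw1
        have hu : IsUnit (Dmᵀ) := by
          rw [Matrix.isUnit_iff_isUnit_det, det_transpose]; exact hDm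
        exact (Matrix.mulVec_injective_iff_isUnit.2 hu) (by simpa using hw1)
      have hw3 : r * (w ⬝ᵥ x) = 0 := by
        rw [← smul_eq_mul, ← dotProduct_smul, ← hx, Matrix.mul_assoc, ← mulVec_mulVec,
          dotProduct_mulVec, ← mulVec_transpose, hst, hw2, zero_dotProduct]
      exact (mul_eq_zero.1 hw3).resolve_left hr0)
    have h6 := hBA x
    rw [hx, dotProduct_smul, smul_eq_mul] at h6
    have h7 := mul_le_mul_of_nonneg_left hray hc
    refine le_of_mul_le_mul_right ?_ hxx
    linarith
  · push Not at hne
    have hB0 := aux_empty _ hB hne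
    have hR : lambdaMinPos (Hsqrt * E * Hsqrt) = 0 := by
      have : {r : ℝ | r ≠ 0 ∧ Module.End.HasEigenvalue (Hsqrt * E * Hsqrt).mulVecLin r} = ∅ := by
        ext r; simpa using hne r
      rw [lambdaMinPos, this, Real.sInf_empty]
    rw [hR]
    rcases eq_or_lt_of_le hc with h0 | h0
    · rw [← h0, mul_zero]
    · have hL : {r : ℝ | r ≠ 0 ∧
          Module.End.HasEigenvalue (Hsqrt * Dm * Dmᵀ * Hsqrt).mulVecLin r} = ∅ := by
        rw [Set.eq_empty_iff_forall_notMem]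
        rintro r ⟨hr0, hr⟩
        obtain ⟨x, hx, hxx, hr1⟩ := aux_eig _ hA r hr
        have h6 := hBA x
        rw [hB0, hx, dotProduct_smul, smul_eq_mul, zero_mulVec, dotProduct_zero] at h6
        have : 0 < r := lt_of_le_of_ne hr1 hr0.symm
        have : 0 < t⁻¹ * (r * (x ⬝ᵥ x)) := by positivity
        linarith
      rw [lambdaMinPos, hL, Real.sInf_empty, zero_mul]
end

section
/- Let A = [a_1, …, a_n] ∈ ℝ^{d×n}, λ > 0, and for i = 1, …, n let φ_i : ℝ → ℝ be twice continuously differentiable with u ≤ φ_i''(t) ≤ ℓ for all t ∈ ℝ, where 0 ≤ u ≤ ℓ. Define the generalized linear model f(x) = (1/n) Σ_{i=1}^n φ_i(a_iᵀ x) + (λ/2)‖x‖², with Hessian H(x) = (1/n) Σ_{i=1}^n φ_i''(a_iᵀ x) a_i a_iᵀ + λI. Then f satisfies relative smoothness and relative convexity on all of ℝ^d with constants L̂ = (ℓ σ_max²(A) + nλ)/(u σ_max²(A) + nλ) and μ̂ = (u σ_max²(A) + nλ)/(ℓ σ_max²(A) + nλ), where σ_max(A) is the largest singular value of A; that is, for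 all x, y ∈ ℝ^d, f(y) + ⟨∇f(y), x−y⟩ + (μ̂/2)‖x−y‖²_{H(y)} ≤ f(x) ≤ f(y) + ⟨∇f(y), x−y⟩ + (L̂/2)‖x−y‖²_{H(y)}. -/
open Matrix

lemma aux_convex (ψ dψ : ℝ → ℝ) (h : ∀ t, HasDerivAt ψ (dψ t) t) (hm : Monotone dψ) (p q : ℝ) :
    ψ p + dψ p * (q - p) ≤ ψ q := by
  have hc : ConvexOn ℝ Set.univ ψ := by
    apply Monotone.convexOn_univ_of_deriv
    · exact fun t => (h t).differentiableAt
    · have : deriv ψ = dψ := funext fun t => (h t).deriv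
      rw [this]; exact hm
  rcases lt_trichotomy p q with hpq | hpq | hpq
  · have := hc.le_slope_of_hasDerivAt (Set.mem_univ p) (Set.mem_univ q) hpq (h p)
    rw [slope_def_field, le_div_iff₀ (by linarith)] at this
    linarith
  · subst hpq; simp
  · have := hc.slope_le_of_hasDerivAt (Set.mem_univ q) (Set.mem_univ p) hpq (h p)
    rw [slope_def_field, div_le_iff₀ (by linarith)] at this
    linarith

lemma aux_taylor (φ : ℝ → ℝ) (hφ : ContDiff ℝ 2 φ) (u l : ℝ)
    (hb : ∀ t, u ≤ deriv (deriv φ) t ∧ deriv (deriv φ) t ≤ l) (p q : ℝ) :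
    φ p + deriv φ p * (q - p) + u / 2 * (q - p) ^ 2 ≤ φ q ∧
    φ q ≤ φ p + deriv φ p * (q - p) + l / 2 * (q - p) ^ 2 := by
  have h1 : ∀ t, HasDerivAt φ (deriv φ t) t := fun t =>
    ((hφ.differentiable (by norm_num)) t).hasDerivAt
  have hφ' : ContDiff ℝ 1 (deriv φ) := by
    have : ContDiff ℝ (1 + 1) φ := by simpa [one_add_one_eq_two] using hφ
    exact (contDiff_succ_iff_deriv.1 this).2.2
  have h2 : ∀ t, HasDerivAt (deriv φ) (deriv (deriv φ) t) t := fun t =>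
    ((hφ'.differentiable (by norm_num)) t).hasDerivAt
  have sq : ∀ m t : ℝ, HasDerivAt (fun t : ℝ => m / 2 * t ^ 2) (m * t) t := by
    intro m t
    have := ((hasDerivAt_id t).pow 2).const_mul (m / 2)
    refine HasDerivAt.congr_deriv this ?_
    simp; ring
  have li : ∀ m t : ℝ, HasDerivAt (fun t : ℝ => m * t) m t := by
    intro m t
    simpa using (hasDerivAt_id t).const_mul m
  constructor
  · have := aux_convex (fun t => φ t - u / 2 * t ^ 2) (fun t => deriv φ t - u * t)
      (fun t => (h1 t).sub (sq u t))
      (monotone_of_hasDerivAt_nonneg (fun t => (h2 t).sub (li u t))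
        (fun t => by have := (hb t).1; simp; linarith)) p q
    nlinarith
  · have := aux_convex (fun t => l / 2 * t ^ 2 - φ t) (fun t => l * t - deriv φ t)
      (fun t => (sq l t).sub (h1 t))
      (monotone_of_hasDerivAt_nonneg (fun t => (li l t).sub (h2 t))
        (fun t => by have := (hb t).2; simp; linarith)) p q
    nlinarith

/-- Relative smoothness and convexity constants of a
generalized linear model `f(x) = (1/n)Σ φ_i(a_iᵀx) + (λ/2)‖x‖²` with
`0 ≤ u ≤ φ_i'' ≤ ℓ` and regularization `λ > 0`:
with `σ² = σ_max²(A)` (the largest eigenvalue of `AAᵀ`, i.e. the maximum of the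
Rayleigh quotient of `AAᵀ` over the unit sphere),
`L̂ = (ℓσ² + nλ)/(uσ² + nλ)` and `μ̂ = (uσ² + nλ)/(ℓσ² + nλ)`, one has for all
`x, y ∈ ℝ^d` the two-sided bound
`f(y) + ⟨∇f(y), x−y⟩ + (μ̂/2)‖x−y‖²_{H(y)} ≤ f(x) ≤
 f(y) + ⟨∇f(y), x−y⟩ + (L̂/2)‖x−y‖²_{H(y)}`. -/
theorem stmt19 {d n : ℕ} (hn : 0 < n)
    (A : Matrix (Fin d) (Fin n) ℝ)
    (a : Fin n → Fin d → ℝ) (ha : ∀ i j, a i j = A j i)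
    (φ : Fin n → ℝ → ℝ) (hφ : ∀ i, ContDiff ℝ 2 (φ i))
    (u l lam : ℝ) (hu : 0 ≤ u) (hul : u ≤ l) (hlam : 0 < lam)
    (hbnd : ∀ i t, u ≤ deriv (deriv (φ i)) t ∧ deriv (deriv (φ i)) t ≤ l)
    (f : (Fin d → ℝ) → ℝ)
    (hf : ∀ x, f x = (1 / (n : ℝ)) * ∑ i, φ i (a i ⬝ᵥ x) + (lam / 2) * (x ⬝ᵥ x))
    (g : (Fin d → ℝ) → (Fin d → ℝ))
    (hg : ∀ x, g x = (1 / (n : ℝ)) • (∑ i, deriv (φ i) (a i ⬝ᵥ x) • a i) + lam • x)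
    (H : (Fin d → ℝ) → Matrix (Fin d) (Fin d) ℝ)
    (hH : ∀ x, H x = (1 / (n : ℝ)) •
      (∑ i, deriv (deriv (φ i)) (a i ⬝ᵥ x) • vecMulVec (a i) (a i)) + lam • 1)
    (σ2 : ℝ)
    (hσ2 : IsGreatest {r : ℝ | ∃ v : Fin d → ℝ, v ⬝ᵥ v = 1 ∧
      r = ((A * Aᵀ) *ᵥ v) ⬝ᵥ v} σ2)
    (Lhat μhat : ℝ)
    (hLhat : Lhat = (l * σ2 + n * lam) / (u * σ2 + n * lam))
    (hμhat : μhat = (u * σ2 + n * lam) / (l * σ2 + n * lam)) :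
    ∀ x y : Fin d → ℝ,
      f y + g y ⬝ᵥ (x - y) + (μhat / 2) * ((H y *ᵥ (x - y)) ⬝ᵥ (x - y)) ≤ f x ∧
      f x ≤ f y + g y ⬝ᵥ (x - y) + (Lhat / 2) * ((H y *ᵥ (x - y)) ⬝ᵥ (x - y)) := by
  intro x y
  have hnR : (0 : ℝ) < n := by exact_mod_cast hn
  obtain ⟨v, hv⟩ : ∃ v, v = x - y := ⟨_, rfl⟩
  have hx : x = y + v := by rw [hv]; simp
  rw [← hv]
  -- quadratic form of `A Aᵀ`
  have hquad : ∀ w : Fin d → ℝ, ((A * Aᵀ) *ᵥ w) ⬝ᵥ w = ∑ i, (a i ⬝ᵥ w) ^ 2 := by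
    intro w
    have h1 : ∀ i, (Aᵀ *ᵥ w) i = a i ⬝ᵥ w := by
      intro i
      simp [mulVec, dotProduct, ha]
    rw [← mulVec_mulVec, dotProduct_comm, dotProduct_mulVec, ← mulVec_transpose]
    simp only [dotProduct.eq_1 (Aᵀ *ᵥ w), h1, sq]
  set S : ℝ := ∑ i, (a i ⬝ᵥ v) ^ 2 with hS
  set N : ℝ := v ⬝ᵥ v with hN
  have hS0 : 0 ≤ S := Finset.sum_nonneg fun i _ => sq_nonneg _
  have hN0 : 0 ≤ N := Finset.sum_nonneg fun i _ => mul_self_nonneg _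
  have hσ0 : 0 ≤ σ2 := by
    obtain ⟨w, _, hw⟩ := hσ2.1
    rw [hw, hquad]
    exact Finset.sum_nonneg fun i _ => sq_nonneg _
  have hSN : S ≤ σ2 * N := by
    rcases hN0.eq_or_lt with h0 | h0
    · have : v = 0 := dotProduct_self_eq_zero.1 (hN ▸ h0.symm)
      rw [← h0, hS, this]; simp
    · have hr : 0 < √N := Real.sqrt_pos.2 h0
      have hrr : √N * √N = N := Real.mul_self_sqrt hN0
      have := (mem_upperBounds.1 hσ2.2) (((A * Aᵀ) *ᵥ ((√N)⁻¹ • v)) ⬝ᵥ ((√N)⁻¹ • v))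
        ⟨(√N)⁻¹ • v, by
          rw [smul_dotProduct, dotProduct_smul, ← hN, smul_eq_mul, smul_eq_mul, ← mul_assoc,
            ← mul_inv, hrr, inv_mul_cancel₀ h0.ne'], rfl⟩
      rw [mulVec_smul, smul_dotProduct, dotProduct_smul, hquad, ← hS, smul_eq_mul, smul_eq_mul,
        ← mul_assoc, ← mul_inv, hrr, inv_mul_le_iff₀ h0] at this
      linarith
  -- Hessian quadratic form
  have hHq : (H y *ᵥ v) ⬝ᵥ v
      = (1 / (n : ℝ)) * ∑ i, deriv (deriv (φ i)) (a i ⬝ᵥ y) * (a i ⬝ᵥ v) ^ 2 + lam * N := by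
    rw [hH, add_mulVec, add_dotProduct, smul_mulVec, smul_mulVec, one_mulVec, smul_dotProduct,
      smul_dotProduct, sum_mulVec, sum_dotProduct]
    simp only [smul_mulVec, smul_dotProduct, smul_eq_mul, vecMulVec_mulVec]
    congr 2
    refine Finset.sum_congr rfl fun i _ => ?_
    simp [smul_dotProduct, sq]
  have hgq : g y ⬝ᵥ v
      = (1 / (n : ℝ)) * ∑ i, deriv (φ i) (a i ⬝ᵥ y) * (a i ⬝ᵥ v) + lam * (y ⬝ᵥ v) := by
    rw [hg, add_dotProduct, smul_dotProduct, smul_dotProduct, sum_dotProduct]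
    simp only [smul_dotProduct, smul_eq_mul]
  have hxx : x ⬝ᵥ x = y ⬝ᵥ y + 2 * (y ⬝ᵥ v) + N := by
    rw [hx, add_dotProduct, dotProduct_add, dotProduct_add, dotProduct_comm v y]; ring
  have hT : ∀ i, φ i (a i ⬝ᵥ y) + deriv (φ i) (a i ⬝ᵥ y) * (a i ⬝ᵥ v)
        + u / 2 * (a i ⬝ᵥ v) ^ 2 ≤ φ i (a i ⬝ᵥ x) ∧
      φ i (a i ⬝ᵥ x) ≤ φ i (a i ⬝ᵥ y) + deriv (φ i) (a i ⬝ᵥ y) * (a i ⬝ᵥ v)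
        + l / 2 * (a i ⬝ᵥ v) ^ 2 := by
    intro i
    have := aux_taylor (φ i) (hφ i) u l (hbnd i) (a i ⬝ᵥ y) (a i ⬝ᵥ x)
    have e : a i ⬝ᵥ x - a i ⬝ᵥ y = a i ⬝ᵥ v := by rw [hv, dotProduct_sub]
    rwa [e] at this
  have hlo := Finset.sum_le_sum fun i (_ : i ∈ Finset.univ) => (hT i).1
  have hhi := Finset.sum_le_sum fun i (_ : i ∈ Finset.univ) => (hT i).2
  simp only [Finset.sum_add_distrib, ← Finset.mul_sum, ← hS] at hlo hhi
  have hQlo : u * S ≤ ∑ i, deriv (deriv (φ i)) (a i ⬝ᵥ y) * (a i ⬝ᵥ v) ^ 2 := by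
    rw [hS, Finset.mul_sum]
    exact Finset.sum_le_sum fun i _ => mul_le_mul_of_nonneg_right (hbnd i _).1 (sq_nonneg _)
  have hQhi : ∑ i, deriv (deriv (φ i)) (a i ⬝ᵥ y) * (a i ⬝ᵥ v) ^ 2 ≤ l * S := by
    rw [hS, Finset.mul_sum]
    exact Finset.sum_le_sum fun i _ => mul_le_mul_of_nonneg_right (hbnd i _).2 (sq_nonneg _)
  rw [hHq, hgq, hf x, hf y, hxx]
  generalize (∑ i, deriv (deriv (φ i)) (a i ⬝ᵥ y) * (a i ⬝ᵥ v) ^ 2) = Q at *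
  generalize (∑ i, deriv (φ i) (a i ⬝ᵥ y) * (a i ⬝ᵥ v)) = G at *
  generalize (∑ i, φ i (a i ⬝ᵥ y)) = Fy at *
  generalize (∑ i, φ i (a i ⬝ᵥ x)) = Fx at *
  generalize y ⬝ᵥ v = yv at *
  generalize y ⬝ᵥ y = yy at *
  clear_value S N
  have hc : 0 < (n : ℝ) * lam := mul_pos hnR hlam
  have hl : 0 ≤ l := hu.trans hul
  have hdu : 0 < u * σ2 + n * lam := by positivity
  have hdl : 0 < l * σ2 + n * lam := by positivity
  have key : 0 ≤ (l - u) * (n * lam) * (σ2 * N - S) :=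
    mul_nonneg (mul_nonneg (by linarith) hc.le) (by linarith)
  have k1 : μhat * (Q + n * lam * N) ≤ u * S + n * lam * N := by
    rw [hμhat, div_mul_eq_mul_div, div_le_iff₀ hdl]
    have := mul_le_mul_of_nonneg_left hQhi hdu.le
    linarith
  have k2 : l * S + n * lam * N ≤ Lhat * (Q + n * lam * N) := by
    rw [hLhat, div_mul_eq_mul_div, le_div_iff₀ hdu]
    have := mul_le_mul_of_nonneg_left hQlo hdl.le
    linarith
  constructor
  · refine le_of_mul_le_mul_left ?_ hnR
    field_simp
    linarith
  · refine le_of_mul_le_mul_left ?_ hnR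
    field_simp
    linarith
end
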